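/- arXiv:1304.3029 — 7 statements merged into one kernel-verified Lean document; each statement's English description precedes it below -/
import Mathlib

section
/- Let (λ_0,…,λ_n) be a well-formed tuple of positive integers with gcd(λ_0,…,λ_n) = 1, let h = λ_0 + ⋯ + λ_n, and let P = conv{ρ_0,…,ρ_n} ⊆ ℚ^n be an associated simplex. Then P ∩ ℤ^n = {ρ_0,…,ρ_n, 0} (i.e. ℙ(λ_0,…,λ_n) has at worst terminal singularities) if and only if for every integer κ with 2 ≤ κ ≤ h − 2 one has 2 ≤ Σ_{i=0}^n {λ_i κ / h} ≤ n − 1. -/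
/-- The convex hull of a finite family consists of the combinations with weights in the standard
simplex. -/
lemma mem_convexHull_range_iff_exists_stdSimplex {ι E : Type*} [Fintype ι] [AddCommGroup E]
    [Module ℚ E] (v : ι → E) (x : E) :
    x ∈ convexHull ℚ (Set.range v) ↔ ∃ w ∈ stdSimplex ℚ ι, ∑ i, w i • v i = x := by
  classical
  constructor
  · intro hx
    have hsub : Set.range v ⊆ Fintype.linearCombination ℚ v '' stdSimplex ℚ ι := by
      rintro _ ⟨i, rfl⟩
      exact ⟨Pi.single i 1, single_mem_stdSimplex ℚ i, by simp⟩
    obtain ⟨w, hw, hwx⟩ :=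
      convexHull_min hsub ((convex_stdSimplex ℚ ι).linear_image (Fintype.linearCombination ℚ v)) hx
    exact ⟨w, hw, by simpa [Fintype.linearCombination_apply] using hwx⟩
  · rintro ⟨w, hw, hwx⟩
    exact mem_convexHull_of_exists_fintype w v hw.1 hw.2 (fun i => Set.mem_range_self i) hwx

/-- If `n + 1` integral vectors generate `ℤⁿ`, any rational linear relation between them is a
multiple of a given nonzero one. -/
lemma exists_eq_mul_of_sum_smul_eq_zero {n : ℕ} {ρ : Fin (n + 1) → Fin n → ℤ}
    (hgen : Submodule.span ℤ (Set.range ρ) = ⊤) {l : Fin (n + 1) → ℚ} (hl : l ≠ 0)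
    (hl0 : ∀ j, ∑ i, l i * (ρ i j : ℚ) = 0) {c : Fin (n + 1) → ℚ}
    (hc : ∀ j, ∑ i, c i * (ρ i j : ℚ) = 0) : ∃ t : ℚ, ∀ i, c i = t * l i := by
  let R : Fin (n + 1) → Fin n → ℚ := fun i j => (ρ i j : ℚ)
  let f := Fintype.linearCombination ℚ R
  have hf : ∀ (w : Fin (n + 1) → ℚ) (j : Fin n), f w j = ∑ i, w i * (ρ i j : ℚ) := by
    intro w j
    simp [f, R, Fintype.linearCombination_apply]
  have hsurj : LinearMap.range f = ⊤ := by
    rw [eq_top_iff, ← (Pi.basisFun ℚ (Fin n)).span_eq, Submodule.span_le]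
    rintro _ ⟨k, rfl⟩
    have hk : (Pi.single k 1 : Fin n → ℤ) ∈ Submodule.span ℤ (Set.range ρ) := by
      rw [hgen]; trivial
    obtain ⟨a, ha⟩ := (Submodule.mem_span_range_iff_exists_fun ℤ).1 hk
    refine ⟨fun i => (a i : ℚ), ?_⟩
    ext j
    rw [hf]
    have hj := congrFun ha j
    simp only [Finset.sum_apply, Pi.smul_apply, smul_eq_mul] at hj
    have hjQ : ((∑ i, a i * ρ i j : ℤ) : ℚ) = ((Pi.single k 1 : Fin n → ℤ) j : ℚ) := by rw [hj]
    push_cast at hjQ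
    rw [hjQ, Pi.basisFun_apply]
    by_cases hjk : j = k
    · subst hjk; simp
    · simp [hjk]
  have hker : Module.finrank ℚ (LinearMap.ker f) = 1 := by
    have := LinearMap.finrank_range_add_finrank_ker f
    rw [hsurj, finrank_top] at this
    simp only [Module.finrank_fin_fun] at this
    omega
  have hlk : l ∈ LinearMap.ker f := by
    rw [LinearMap.mem_ker]; ext j; rw [hf]; exact hl0 j
  have hck : c ∈ LinearMap.ker f := by
    rw [LinearMap.mem_ker]; ext j; rw [hf]; exact hc j
  have hne : (⟨l, hlk⟩ : LinearMap.ker f) ≠ 0 := fun h => hl (congrArg Subtype.val h)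
  obtain ⟨t, ht⟩ := exists_smul_eq_of_finrank_eq_one hker hne ⟨c, hck⟩
  refine ⟨t, fun i => ?_⟩
  have := congrFun (congrArg Subtype.val ht) i
  simpa using this.symm

/-- A common divisor of all the multiples `lam i * m` divides `m` when the `lam i` have gcd one. -/
lemma int_dvd_of_forall_dvd_mul {ι : Type*} [Fintype ι] {lam : ι → ℕ}
    (hgcd : Finset.univ.gcd lam = 1) {h : ℕ} {m : ℤ} (H : ∀ i, (h : ℤ) ∣ (lam i : ℤ) * m) :
    (h : ℤ) ∣ m := by
  have h1 : h ∣ Finset.univ.gcd fun i => lam i * m.natAbs := by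
    refine Finset.dvd_gcd fun i _ => ?_
    have := Int.natAbs_dvd_natAbs.2 (H i)
    simpa [Int.natAbs_mul] using this
  rw [Finset.gcd_mul_right, hgcd] at h1
  rw [← Int.natAbs_dvd_natAbs]
  simpa using h1

lemma int_dvd_of_forall_mul_div_eq_int {ι : Type*} [Fintype ι] {lam : ι → ℕ}
    (hgcd : Finset.univ.gcd lam = 1) {h : ℕ} (hh : h ≠ 0) {m : ℤ}
    (H : ∀ i, ∃ z : ℤ, (lam i : ℚ) * m / h = z) : (h : ℤ) ∣ m := by
  refine int_dvd_of_forall_dvd_mul hgcd fun i => ?_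
  obtain ⟨z, hz⟩ := H i
  have hh' : (h : ℚ) ≠ 0 := by exact_mod_cast hh
  rw [div_eq_iff hh'] at hz
  refine ⟨z, ?_⟩
  rw [mul_comm (h : ℤ)]
  exact_mod_cast hz

/-- Each of at least two positive weights is smaller than their sum. -/
lemma lt_of_eq_sum {n : ℕ} (hn : 1 ≤ n) {lam : Fin (n + 1) → ℕ} (hpos : ∀ i, 0 < lam i) {h : ℕ}
    (hh : h = ∑ i, lam i) (i : Fin (n + 1)) : lam i < h := by
  have : Nontrivial (Fin (n + 1)) := Fin.nontrivial_iff_two_le.2 (by omega)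
  obtain ⟨k, hk⟩ := exists_ne i
  rw [hh]
  exact Finset.single_lt_sum hk (Finset.mem_univ i) (Finset.mem_univ k) (hpos k)
    fun _ _ _ => Nat.zero_le _

/-- The lattice points of the simplex are its vertices and the origin if and only if the
fractional parts `{lam i * κ / h}` sum to one only for `κ ≡ 1` modulo `h`. -/
lemma lattice_points_simplex_iff {n : ℕ} (hn : 1 ≤ n) {lam : Fin (n + 1) → ℕ}
    (hpos : ∀ i, 0 < lam i) (hgcd : Finset.univ.gcd lam = 1) {h : ℕ} (hh : h = ∑ i, lam i)
    {ρ : Fin (n + 1) → Fin n → ℤ} (hgen : Submodule.span ℤ (Set.range ρ) = ⊤)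
    (hzero : ∑ i, (lam i : ℤ) • ρ i = 0) :
    {x | x ∈ convexHull ℚ (Set.range fun i => fun j => (ρ i j : ℚ)) ∧
        ∀ j, ∃ z : ℤ, x j = (z : ℚ)} = Set.range (fun i => fun j => (ρ i j : ℚ)) ∪ {0} ↔
      ∀ κ : ℤ, ∑ i, Int.fract ((lam i : ℚ) * (κ : ℚ) / (h : ℚ)) = 1 → (h : ℤ) ∣ κ - 1 := by
  classical
  have hhpos : 0 < h := by
    rw [hh]; exact Finset.sum_pos (fun i _ => hpos i) Finset.univ_nonempty
  have hhQ : (h : ℚ) ≠ 0 := by exact_mod_cast hhpos.ne'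
  have hsumQ : ∑ i, (lam i : ℚ) = h := by rw [hh]; push_cast; rfl
  have hl0 : ∀ j, ∑ i, (lam i : ℚ) * (ρ i j : ℚ) = 0 := by
    intro j
    have := congrFun hzero j
    simp only [Finset.sum_apply, Pi.smul_apply, smul_eq_mul, Pi.zero_apply] at this
    exact_mod_cast this
  have hl : (fun i => (lam i : ℚ)) ≠ 0 := by
    intro h0
    have := congrFun h0 0
    simp [(hpos 0).ne'] at this
  constructor
  · intro hP κ hκ
    set w : Fin (n + 1) → ℚ := fun i => Int.fract ((lam i : ℚ) * (κ : ℚ) / (h : ℚ)) with hw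
    set x : Fin n → ℚ := fun j => ∑ i, w i * (ρ i j : ℚ) with hx
    have hxP : x ∈ Set.range (fun i => fun j => (ρ i j : ℚ)) ∪ {0} := by
      rw [← hP]
      refine ⟨?_, fun j => ⟨-∑ i, ⌊(lam i : ℚ) * (κ : ℚ) / (h : ℚ)⌋ * ρ i j, ?_⟩⟩
      · rw [mem_convexHull_range_iff_exists_stdSimplex]
        refine ⟨w, ⟨fun i => Int.fract_nonneg _, hκ⟩, ?_⟩
        ext j; simp [hx]
      · have e : ∀ i, w i * (ρ i j : ℚ) = (κ / h : ℚ) * ((lam i : ℚ) * (ρ i j : ℚ)) -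
            (⌊(lam i : ℚ) * (κ : ℚ) / (h : ℚ)⌋ : ℚ) * (ρ i j : ℚ) := by
          intro i
          simp only [hw, Int.fract]
          ring
        simp only [hx, e, Finset.sum_sub_distrib, ← Finset.mul_sum, hl0]
        push_cast
        ring
    rcases hxP with ⟨k, hk⟩ | h0
    · exfalso
      have hrel : ∀ j, ∑ i, (w i - (Pi.single k 1 : Fin (n + 1) → ℚ) i) * (ρ i j : ℚ) = 0 := by
        intro j
        have hkj := congrFun hk j
        simp only [hx] at hkj
        simp [sub_mul, Finset.sum_sub_distrib, Pi.single_apply, ← hkj]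
      obtain ⟨t, ht⟩ := exists_eq_mul_of_sum_smul_eq_zero hgen hl hl0 hrel
      have ht0 : t * h = 0 := by
        rw [← hsumQ, Finset.mul_sum, ← Finset.sum_congr rfl fun i _ => ht i,
          Finset.sum_sub_distrib, hκ]
        simp
      have ht0' : t = 0 := by simpa [hhQ] using ht0
      have := ht k
      rw [ht0'] at this
      have hlt : w k < 1 := Int.fract_lt_one _
      simp at this
      linarith
    · have h0' : x = 0 := h0
      have hrel : ∀ j, ∑ i, w i * (ρ i j : ℚ) = 0 := fun j => congrFun h0' j
      obtain ⟨t, ht⟩ := exists_eq_mul_of_sum_smul_eq_zero hgen hl hl0 hrel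
      have ht1 : t * h = 1 := by
        rw [← hsumQ, Finset.mul_sum, ← Finset.sum_congr rfl fun i _ => ht i, hκ]
      have ht1' : t = 1 / h := by field_simp; linarith
      refine int_dvd_of_forall_mul_div_eq_int hgcd hhpos.ne'
        fun i => ⟨⌊(lam i : ℚ) * (κ : ℚ) / (h : ℚ)⌋, ?_⟩
      have hti := ht i
      simp only [hw, Int.fract, ht1'] at hti
      push_cast
      rw [mul_sub, sub_div]
      linear_combination hti
  · intro H
    ext x
    constructor
    · rintro ⟨hxP, hxZ⟩
      rw [mem_convexHull_range_iff_exists_stdSimplex] at hxP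
      obtain ⟨w, ⟨hw0, hw1⟩, hwx⟩ := hxP
      have hwx' : ∀ j, ∑ i, w i * (ρ i j : ℚ) = x j := by
        intro j; rw [← hwx]; simp
      by_cases hbig : ∃ k, 1 ≤ w k
      · obtain ⟨k, hk⟩ := hbig
        left
        have hsplit := Finset.add_sum_erase Finset.univ w (Finset.mem_univ k)
        have hother0 : ∑ i ∈ Finset.univ.erase k, w i = 0 :=
          le_antisymm (by linarith) (Finset.sum_nonneg fun i _ => hw0 i)
        have hother : ∀ i, i ≠ k → w i = 0 := fun i hi =>
          (Finset.sum_eq_zero_iff_of_nonneg fun i _ => hw0 i).1 hother0 i (by simp [hi])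
        have hwk : w k = 1 := by linarith
        refine ⟨k, ?_⟩
        ext j
        rw [← hwx' j, Finset.sum_eq_single k (fun i _ hi => by simp [hother i hi]) (by simp)]
        simp [hwk]
      · push Not at hbig
        right
        choose z hz using hxZ
        have hzs : z ∈ Submodule.span ℤ (Set.range ρ) := by rw [hgen]; trivial
        obtain ⟨a, ha⟩ := (Submodule.mem_span_range_iff_exists_fun ℤ).1 hzs
        have haj : ∀ j, ∑ i, (a i : ℚ) * (ρ i j : ℚ) = x j := by
          intro j
          have := congrFun ha j
          simp only [Finset.sum_apply, Pi.smul_apply, smul_eq_mul] at this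
          rw [hz, ← this]; push_cast; rfl
        have hrel : ∀ j, ∑ i, (w i - a i) * (ρ i j : ℚ) = 0 := by
          intro j
          simp only [sub_mul, Finset.sum_sub_distrib, hwx', haj, sub_self]
        obtain ⟨t, ht⟩ := exists_eq_mul_of_sum_smul_eq_zero hgen hl hl0 hrel
        have hth : t * h = 1 - ∑ i, (a i : ℚ) := by
          rw [← hsumQ, Finset.mul_sum, ← Finset.sum_congr rfl fun i _ => ht i,
            Finset.sum_sub_distrib, hw1]
        set κ : ℤ := 1 - ∑ i, a i with hκ
        have htκ : t = (κ : ℚ) / h := by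
          rw [eq_div_iff hhQ, hth, hκ]; push_cast; rfl
        have hfr : ∀ i, Int.fract ((lam i : ℚ) * (κ : ℚ) / (h : ℚ)) = w i := by
          intro i
          rw [Int.fract_eq_iff]
          refine ⟨hw0 i, hbig i, -a i, ?_⟩
          have := ht i
          rw [htκ] at this
          push_cast
          linear_combination -this
        obtain ⟨m, hm⟩ := H κ (by simp only [hfr, hw1])
        have hκm : (κ : ℚ) = 1 + h * m := by
          have : κ = 1 + h * m := by linarith
          exact_mod_cast this
        have hlamh : ∀ i, (lam i : ℚ) < h := by
          intro i
          have hi : lam i < h := lt_of_eq_sum hn hpos hh i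
          exact_mod_cast hi
        have hwl : ∀ i, w i = (lam i : ℚ) / h := by
          intro i
          rw [← hfr, Int.fract_eq_iff]
          refine ⟨by positivity, ?_, lam i * m, ?_⟩
          · rw [div_lt_one (by positivity)]; exact hlamh i
          · rw [hκm]; push_cast; field_simp; ring
        change x = 0
        ext j
        rw [← hwx' j]
        simp only [hwl, div_mul_eq_mul_div, ← Finset.sum_div, hl0]
        simp
    · rintro (⟨k, rfl⟩ | h0)
      · exact ⟨subset_convexHull ℚ _ ⟨k, rfl⟩, fun j => ⟨ρ k j, rfl⟩⟩
      · have h0' : x = 0 := h0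
        subst h0'
        refine ⟨?_, fun j => ⟨0, by simp⟩⟩
        rw [mem_convexHull_range_iff_exists_stdSimplex]
        refine ⟨fun i => (lam i : ℚ) / h, ⟨fun i => by positivity, ?_⟩, ?_⟩
        · rw [← Finset.sum_div, hsumQ, div_self hhQ]
        · ext j
          simp [div_mul_eq_mul_div, ← Finset.sum_div, hl0]

/-- The fractional parts `{lam i * κ / h}` sum to one only for `κ ≡ 1` modulo `h` if and only if
their sum lies between `2` and `n - 1` for all `2 ≤ κ ≤ h - 2`. -/
lemma sum_fract_eq_one_iff_bounds {n : ℕ} (hn : 1 ≤ n) {lam : Fin (n + 1) → ℕ}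
    (hpos : ∀ i, 0 < lam i) (hgcd : Finset.univ.gcd lam = 1)
    (hwf : ∀ i : Fin (n + 1), (Finset.univ.erase i).gcd lam = 1)
    {h : ℕ} (hh : h = ∑ i, lam i) :
    (∀ κ : ℤ, ∑ i, Int.fract ((lam i : ℚ) * (κ : ℚ) / (h : ℚ)) = 1 → (h : ℤ) ∣ κ - 1) ↔
      ∀ κ : ℤ, 2 ≤ κ → κ ≤ (h : ℤ) - 2 →
        2 ≤ ∑ i, Int.fract ((lam i : ℚ) * (κ : ℚ) / (h : ℚ)) ∧
          ∑ i, Int.fract ((lam i : ℚ) * (κ : ℚ) / (h : ℚ)) ≤ (n : ℚ) - 1 := by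
  classical
  have hhpos : 0 < h := by
    rw [hh]; exact Finset.sum_pos (fun i _ => hpos i) Finset.univ_nonempty
  have hhQ : (h : ℚ) ≠ 0 := by exact_mod_cast hhpos.ne'
  have hsumQ : ∑ i, (lam i : ℚ) = h := by rw [hh]; push_cast; rfl
  have hint : ∀ κ : ℤ, ∃ m : ℤ, ∑ i, Int.fract ((lam i : ℚ) * (κ : ℚ) / (h : ℚ)) = m := by
    intro κ
    refine ⟨κ - ∑ i, ⌊(lam i : ℚ) * (κ : ℚ) / (h : ℚ)⌋, ?_⟩
    simp only [Int.fract, Finset.sum_sub_distrib, ← Finset.sum_div, ← Finset.sum_mul, hsumQ]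
    push_cast
    field_simp
  have hnonneg : ∀ κ : ℤ, 0 ≤ ∑ i, Int.fract ((lam i : ℚ) * (κ : ℚ) / (h : ℚ)) :=
    fun κ => Finset.sum_nonneg fun i _ => Int.fract_nonneg _
  have hzero : ∀ κ : ℤ, ∑ i, Int.fract ((lam i : ℚ) * (κ : ℚ) / (h : ℚ)) = 0 →
      (h : ℤ) ∣ κ := by
    intro κ hκ
    have hall := (Finset.sum_eq_zero_iff_of_nonneg fun i _ => Int.fract_nonneg _).1 hκ
    refine int_dvd_of_forall_mul_div_eq_int hgcd hhpos.ne' fun i => ?_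
    obtain ⟨z, hz⟩ := Int.fract_eq_zero_iff.1 (hall i (Finset.mem_univ i))
    exact ⟨z, hz.symm⟩
  have hnotdvd : ∀ κ : ℤ, 0 < κ → κ < h → ¬ (h : ℤ) ∣ κ := fun κ h1 h2 h3 =>
    absurd (Int.le_of_dvd h1 h3) (by omega)
  have hper : ∀ (κ m : ℤ) (i : Fin (n + 1)),
      Int.fract ((lam i : ℚ) * ((κ + h * m : ℤ) : ℚ) / (h : ℚ)) =
        Int.fract ((lam i : ℚ) * (κ : ℚ) / (h : ℚ)) := by
    intro κ m i
    rw [Int.fract_eq_fract]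
    refine ⟨lam i * m, ?_⟩
    push_cast
    field_simp
    ring
  have hneg : ∀ (κ : ℤ) (i : Fin (n + 1)),
      (lam i : ℚ) * ((h - κ : ℤ) : ℚ) / (h : ℚ) =
        -((lam i : ℚ) * (κ : ℚ) / (h : ℚ)) + (lam i : ℤ) := by
    intro κ i
    push_cast
    field_simp
    ring
  constructor
  · intro H
    have two_le : ∀ κ : ℤ, 2 ≤ κ → κ ≤ (h : ℤ) - 2 →
        2 ≤ ∑ i, Int.fract ((lam i : ℚ) * (κ : ℚ) / (h : ℚ)) := by
      intro κ h2 hk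
      have hne0 := mt (hzero κ) (hnotdvd κ (by omega) (by omega))
      have hne1 := mt (H κ) (hnotdvd (κ - 1) (by omega) (by omega))
      have hge := hnonneg κ
      obtain ⟨m, hm⟩ := hint κ
      rw [hm] at hne0 hne1 hge ⊢
      norm_cast at hne0 hne1 hge ⊢
      omega
    intro κ h2 hk
    refine ⟨two_le κ h2 hk, ?_⟩
    have hrefl := two_le (h - κ) (by omega) (by omega)
    have hle : ∀ i, Int.fract ((lam i : ℚ) * (κ : ℚ) / (h : ℚ)) ≤
        1 - Int.fract ((lam i : ℚ) * ((h - κ : ℤ) : ℚ) / (h : ℚ)) := by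
      intro i
      rw [hneg, Int.fract_add_intCast]
      by_cases h0 : Int.fract ((lam i : ℚ) * (κ : ℚ) / (h : ℚ)) = 0
      · rw [h0]
        linarith [Int.fract_lt_one (-((lam i : ℚ) * (κ : ℚ) / (h : ℚ)))]
      · rw [Int.fract_neg h0]
        linarith
    have := Finset.sum_le_sum fun i (_ : i ∈ Finset.univ) => hle i
    rw [Finset.sum_sub_distrib] at this
    simp only [Finset.sum_const, Finset.card_univ, Fintype.card_fin, nsmul_eq_mul] at this
    push_cast at this hrefl ⊢
    linarith
  · intro H κ hκ
    set r := κ % h with hr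
    have hκr : κ = r + h * (κ / h) := by rw [hr]; exact (Int.emod_add_mul_ediv κ h).symm
    have hr0 : 0 ≤ r := Int.emod_nonneg _ (by omega)
    have hrh : r < h := Int.emod_lt_of_pos _ (by omega)
    have hSr : ∑ i, Int.fract ((lam i : ℚ) * (r : ℚ) / (h : ℚ)) = 1 := by
      rw [← hκ]
      refine Finset.sum_congr rfl fun i _ => ?_
      conv_rhs => rw [hκr]
      exact (hper r (κ / h) i).symm
    suffices hr1 : (h : ℤ) ∣ r - 1 by
      rw [hκr, add_sub_right_comm]
      exact dvd_add hr1 (dvd_mul_right _ _)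
    rcases eq_or_ne r 0 with h0 | h0
    · rw [h0] at hSr; simp at hSr
    rcases eq_or_ne r 1 with h1 | h1
    · simp [h1]
    rcases lt_or_ge ((h : ℤ) - 2) r with hlast | hmid
    · have hrl : r = h - 1 := by omega
      have hfr : ∀ i, Int.fract ((lam i : ℚ) * (r : ℚ) / (h : ℚ)) = 1 - (lam i : ℚ) / h := by
        intro i
        have hi : lam i < h := lt_of_eq_sum hn hpos hh i
        have hiQ : (lam i : ℚ) < h := by exact_mod_cast hi
        have hi0 : (0 : ℚ) < lam i := by exact_mod_cast hpos i
        have hh0 : (0 : ℚ) < h := by exact_mod_cast hhpos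
        rw [Int.fract_eq_iff]
        refine ⟨?_, ?_, lam i - 1, ?_⟩
        · rw [sub_nonneg, div_le_one hh0]; exact hiQ.le
        · have := div_pos hi0 hh0
          linarith
        · rw [hrl]; push_cast; field_simp; ring
      simp only [hfr, Finset.sum_sub_distrib, ← Finset.sum_div, hsumQ, div_self hhQ] at hSr
      simp at hSr
      subst hSr
      have h00 := hwf 0
      have h11 := hwf 1
      have e0 : (Finset.univ.erase (0 : Fin (1 + 1))) = {1} := by decide
      have e1 : (Finset.univ.erase (1 : Fin (1 + 1))) = {0} := by decide
      rw [e0] at h00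
      rw [e1] at h11
      simp at h00 h11
      have : h = 2 := by rw [hh, Fin.sum_univ_two, h00, h11]
      omega
    · have := (H r (by omega) hmid).1
      rw [hSr] at this
      norm_num at this

/-- **Proposition 2.3 (terminal criterion).** Let `(λ₀,…,λₙ)` be well-formed weights with
`gcd = 1`, `h = λ₀ + ⋯ + λₙ`, and let `P = conv{ρ₀,…,ρₙ} ⊆ ℚⁿ` be an associated simplex.
Then `P ∩ ℤⁿ = {ρ₀,…,ρₙ, 0}` (terminality) iff for every integer `κ` with `2 ≤ κ ≤ h − 2`
one has `2 ≤ Σᵢ {λᵢκ/h} ≤ n − 1`. -/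
theorem stmt_0 (n : ℕ) (lam : Fin (n + 1) → ℕ)
    (hpos : ∀ i, 0 < lam i)
    (hgcd : Finset.univ.gcd lam = 1)
    (hwf : ∀ i : Fin (n + 1), (Finset.univ.erase i).gcd lam = 1)
    (h : ℕ) (hh : h = ∑ i, lam i)
    (ρ : Fin (n + 1) → Fin n → ℤ)
    (hprim : ∀ i, Finset.univ.gcd (ρ i) = 1)
    (hgen : Submodule.span ℤ (Set.range ρ) = ⊤)
    (hzero : ∑ i, (lam i : ℤ) • ρ i = 0)
    (P : Set (Fin n → ℚ))
    (hP : P = convexHull ℚ (Set.range fun i => fun j => (ρ i j : ℚ))) :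
    {x | x ∈ P ∧ ∀ j, ∃ z : ℤ, x j = (z : ℚ)}
        = Set.range (fun i => fun j => (ρ i j : ℚ)) ∪ {0} ↔
      ∀ κ : ℤ, 2 ≤ κ → κ ≤ (h : ℤ) - 2 →
        2 ≤ ∑ i, Int.fract ((lam i : ℚ) * (κ : ℚ) / (h : ℚ)) ∧
          ∑ i, Int.fract ((lam i : ℚ) * (κ : ℚ) / (h : ℚ)) ≤ (n : ℚ) - 1 := by
  have hn : 1 ≤ n := by
    rcases Nat.eq_zero_or_pos n with rfl | hn
    · simpa using hprim 0
    · exact hn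
  subst hP
  exact (lattice_points_simplex_iff hn hpos hgcd hh hgen hzero).trans
    (sum_fract_eq_one_iff_bounds hn hpos hgcd hwf hh)
end

section
/- Let (λ_0,…,λ_n) be a well-formed tuple of positive integers with gcd(λ_0,…,λ_n) = 1, let h = λ_0 + ⋯ + λ_n, and let P = conv{ρ_0,…,ρ_n} ⊆ ℚ^n be an associated simplex. Then the origin is the only lattice point in the interior of P, i.e. int(P) ∩ ℤ^n = {0} (so ℙ(λ_0,…,λ_n) has at worst canonical singularities), if and only if for every integer κ with 2 ≤ κ ≤ h − 2 one has 1 ≤ Σ_{i=0}^n {λ_i κ / h} ≤ n − 1. -/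
/-- A point of the convex hull of a finite family is a convex combination of the whole family. -/
lemma exists_weights_of_mem_convexHull_range {ι E : Type*} [Fintype ι] [AddCommGroup E]
    [Module ℚ E] {v : ι → E} {x : E} (hx : x ∈ convexHull ℚ (Set.range v)) :
    ∃ b : ι → ℚ, (∀ i, 0 ≤ b i) ∧ ∑ i, b i = 1 ∧ ∑ i, b i • v i = x := by
  classical
  have hsub : convexHull ℚ (Set.range v) ⊆ Fintype.linearCombination ℚ v '' stdSimplex ℚ ι := by
    refine convexHull_min ?_ ((convex_stdSimplex ℚ ι).linear_image _)
    rintro _ ⟨i, rfl⟩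
    exact ⟨Pi.single i 1, single_mem_stdSimplex ℚ i, by simp⟩
  obtain ⟨b, hb, rfl⟩ := hsub hx
  exact ⟨b, hb.1, hb.2, rfl⟩

/-- If the origin is a convex combination with positive weights of a spanning family, then the
interior of its convex hull consists of the convex combinations with positive weights. -/
lemma mem_interior_convexHull_range_iff {ι : Type*} [Fintype ι] {n : ℕ} {v : ι → Fin n → ℚ}
    (hspan : Submodule.span ℚ (Set.range v) = ⊤) {w : ι → ℚ} (hw : ∀ i, 0 < w i)
    (hw1 : ∑ i, w i = 1) (hw0 : ∑ i, w i • v i = 0) (x : Fin n → ℚ) :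
    x ∈ interior (convexHull ℚ (Set.range v)) ↔
      ∃ b : ι → ℚ, (∀ i, 0 < b i) ∧ ∑ i, b i = 1 ∧ ∑ i, b i • v i = x := by
  constructor
  · intro hx
    have hcont : ContinuousAt (fun e : ℚ => (1 + e) • x) 0 := by fun_prop
    have hmem : ∀ᶠ e : ℚ in nhds 0, (1 + e) • x ∈ convexHull ℚ (Set.range v) := by
      refine hcont.eventually_mem ?_
      simpa using mem_interior_iff_mem_nhds.1 hx
    obtain ⟨ε, hε, hball⟩ := Metric.eventually_nhds_iff.1 hmem
    obtain ⟨e, he0, heε⟩ := exists_rat_btwn hε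
    have he : 0 < e := by exact_mod_cast he0
    have hy := @hball e (by
      rw [dist_zero_right, ← Rat.norm_cast_real, Real.norm_of_nonneg he0.le]; exact heε)
    obtain ⟨c, hc, hc1, hcx⟩ := exists_weights_of_mem_convexHull_range hy
    have hne : 1 + e ≠ 0 := by positivity
    refine ⟨fun i => (1 + e)⁻¹ * (c i + e * w i), fun i => ?_, ?_, ?_⟩
    · have := hc i
      have := hw i
      positivity
    · rw [← Finset.mul_sum, Finset.sum_add_distrib, ← Finset.mul_sum, hc1, hw1, mul_one,
        inv_mul_cancel₀ hne]
    · simp_rw [mul_smul, add_smul, mul_smul]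
      rw [← Finset.smul_sum, Finset.sum_add_distrib, ← Finset.smul_sum, hw0, hcx, smul_zero,
        add_zero, inv_smul_smul₀ hne]
  · rintro ⟨b, hb, hb1, hbx⟩
    have hex : ∀ j : Fin n, ∃ a : ι → ℚ, ∑ i, a i • v i = Pi.single j 1 := fun j =>
      (Submodule.mem_span_range_iff_exists_fun ℚ).1 (hspan ▸ Submodule.mem_top)
    choose a ha using hex
    let d : (Fin n → ℚ) → ι → ℚ := fun y i => ∑ j, (y j - x j) * a j i
    let c : (Fin n → ℚ) → ι → ℚ := fun y i => b i + d y i - (∑ k, d y k) * w i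
    have hd : ∀ y, ∑ i, d y i • v i = y - x := by
      intro y
      simp_rw [d, Finset.sum_smul, mul_smul]
      rw [Finset.sum_comm]
      simp_rw [← Finset.smul_sum, ha]
      exact (pi_eq_sum_univ' (y - x)).symm
    have hcpos : ∀ᶠ y in nhds x, ∀ i, 0 < c y i := by
      refine Filter.eventually_all.2 fun i => ?_
      have hcont : ContinuousAt (fun y => c y i) x := by
        simp only [c, d]
        fun_prop
      refine hcont.eventually (lt_mem_nhds ?_)
      simpa [c, d] using hb i
    refine mem_interior_iff_mem_nhds.2 (Filter.mem_of_superset hcpos fun y hy => ?_)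
    refine mem_convexHull_of_exists_fintype (c y) v (fun i => (hy i).le) ?_
      (fun i => Set.mem_range_self i) ?_
    · simp only [c, Finset.sum_sub_distrib, Finset.sum_add_distrib, ← Finset.mul_sum, hb1, hw1]
      ring
    · simp only [c, sub_smul, add_smul, mul_smul, Finset.sum_sub_distrib,
        Finset.sum_add_distrib, ← Finset.smul_sum, hd, hbx, hw0]
      simp

/-- Linear relations among `n + 1` vectors spanning `ℚⁿ` are proportional. -/
lemma exists_eq_smul_of_relation {n : ℕ} {v : Fin (n + 1) → Fin n → ℚ}
    (hspan : Submodule.span ℚ (Set.range v) = ⊤) {w : Fin (n + 1) → ℚ} (hw : w ≠ 0)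
    (hw0 : ∑ i, w i • v i = 0) {c : Fin (n + 1) → ℚ} (hc : ∑ i, c i • v i = 0) :
    ∃ t : ℚ, ∀ i, c i = t * w i := by
  let f := Fintype.linearCombination ℚ v
  have hrank := f.finrank_range_add_finrank_ker
  rw [Fintype.range_linearCombination, hspan, finrank_top, Module.finrank_fin_fun,
    Module.finrank_fin_fun] at hrank
  have hker : Module.finrank ℚ (LinearMap.ker f) = 1 := by omega
  let w' : LinearMap.ker f := ⟨w, hw0⟩
  have hw' : w' ≠ 0 := fun hzero => hw (congrArg Subtype.val hzero)
  obtain ⟨t, ht⟩ := (finrank_eq_one_iff_of_nonzero' w' hw').1 hker ⟨c, hc⟩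
  exact ⟨t, fun i => (congrFun (congrArg Subtype.val ht) i).symm⟩

/-- Integral generators of `ℤⁿ` span `ℚⁿ`. -/
lemma span_rat_eq_top_of_span_int {ι : Type*} [Fintype ι] {n : ℕ} {ρ : ι → Fin n → ℤ}
    (hgen : Submodule.span ℤ (Set.range ρ) = ⊤) :
    Submodule.span ℚ (Set.range fun i => fun j => (ρ i j : ℚ)) = ⊤ := by
  refine eq_top_iff.2 fun x _ => ?_
  rw [pi_eq_sum_univ' x]
  refine Submodule.sum_mem _ fun j _ => Submodule.smul_mem _ _ ?_
  obtain ⟨a, ha⟩ := (Submodule.mem_span_range_iff_exists_fun ℤ (x := Pi.single j (1 : ℤ))).1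
    (hgen ▸ Submodule.mem_top)
  refine (Submodule.mem_span_range_iff_exists_fun ℚ).2 ⟨fun i => a i, ?_⟩
  ext k
  have hk := congrArg (Int.cast : ℤ → ℚ) (congrFun ha k)
  simpa [Finset.sum_apply, Pi.single_apply, eq_comm] using hk

/-- If `h` divides each `λᵢ k` in the sense that `λᵢ k / h` is an integer, and the `λᵢ` are
coprime, then `h` divides `k`. -/
lemma dvd_of_forall_mul_div_eq_intCast {ι : Type*} [Fintype ι] {lam : ι → ℕ}
    (hgcd : Finset.univ.gcd lam = 1) {h : ℕ} (hh : h ≠ 0) {k : ℤ}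
    (hk : ∀ i, ∃ z : ℤ, (lam i : ℚ) * (k : ℚ) / (h : ℚ) = z) : (h : ℤ) ∣ k := by
  have hdvd : ∀ i, h ∣ lam i * k.natAbs := by
    intro i
    obtain ⟨z, hz⟩ := hk i
    rw [div_eq_iff (by exact_mod_cast hh)] at hz
    have hz' : (lam i : ℤ) * k = z * h := by exact_mod_cast hz
    have : (h : ℤ) ∣ (lam i : ℤ) * k := ⟨z, by rw [hz', mul_comm]⟩
    simpa [Int.natAbs_mul] using Int.natAbs_dvd_natAbs.2 this
  have hall : h ∣ Finset.univ.gcd fun i => lam i * k.natAbs := Finset.dvd_gcd fun i _ => hdvd i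
  rw [Finset.gcd_mul_right, hgcd] at hall
  exact Int.natCast_dvd.2 (by simpa using hall)

/-- The sum of the fractional parts of `λᵢ κ / h` is an integer when `h = ∑ λᵢ`. -/
lemma exists_sum_fract_eq_intCast {ι : Type*} [Fintype ι] {lam : ι → ℕ} {h : ℕ} (hh : h ≠ 0)
    (hsum : h = ∑ i, lam i) (κ : ℤ) :
    ∃ z : ℤ, ∑ i, Int.fract ((lam i : ℚ) * (κ : ℚ) / (h : ℚ)) = z := by
  refine ⟨κ - ∑ i, ⌊(lam i : ℚ) * (κ : ℚ) / (h : ℚ)⌋, ?_⟩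
  have hne : (h : ℚ) ≠ 0 := by exact_mod_cast hh
  have hq : ∑ i, (lam i : ℚ) = h := by exact_mod_cast hsum.symm
  simp_rw [Int.fract]
  rw [Finset.sum_sub_distrib, ← Finset.sum_div, ← Finset.sum_mul, hq, mul_div_cancel_left₀ _ hne]
  push_cast
  rfl


/-- **Proposition 2.5 (canonical criterion).** Let `(λ₀,…,λₙ)` be well-formed weights with
`gcd = 1`, `h = λ₀ + ⋯ + λₙ`, and let `P = conv{ρ₀,…,ρₙ} ⊆ ℚⁿ` be an associated simplex.
Then the origin is the only lattice point in the interior of `P` (canonicity) iff for every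
integer `κ` with `2 ≤ κ ≤ h − 2` one has `1 ≤ Σᵢ {λᵢκ/h} ≤ n − 1`. -/
theorem stmt_2 (n : ℕ) (lam : Fin (n + 1) → ℕ)
    (hpos : ∀ i, 0 < lam i)
    (hgcd : Finset.univ.gcd lam = 1)
    (hwf : ∀ i : Fin (n + 1), (Finset.univ.erase i).gcd lam = 1)
    (h : ℕ) (hh : h = ∑ i, lam i)
    (ρ : Fin (n + 1) → Fin n → ℤ)
    (hprim : ∀ i, Finset.univ.gcd (ρ i) = 1)
    (hgen : Submodule.span ℤ (Set.range ρ) = ⊤)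
    (hzero : ∑ i, (lam i : ℤ) • ρ i = 0)
    (P : Set (Fin n → ℚ))
    (hP : P = convexHull ℚ (Set.range fun i => fun j => (ρ i j : ℚ))) :
    {x | x ∈ interior P ∧ ∀ j, ∃ z : ℤ, x j = (z : ℚ)} = {0} ↔
      ∀ κ : ℤ, 2 ≤ κ → κ ≤ (h : ℤ) - 2 →
        1 ≤ ∑ i, Int.fract ((lam i : ℚ) * (κ : ℚ) / (h : ℚ)) ∧
          ∑ i, Int.fract ((lam i : ℚ) * (κ : ℚ) / (h : ℚ)) ≤ (n : ℚ) - 1 := by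
  have hn : 1 ≤ n := by
    rcases Nat.eq_zero_or_pos n with rfl | hn
    · simpa using hprim 0
    · exact hn
  have hnh : n + 1 ≤ h := by
    simpa [hh] using Finset.card_nsmul_le_sum Finset.univ lam 1 fun i _ => hpos i
  have hne : (h : ℚ) ≠ 0 := by exact_mod_cast (by omega : h ≠ 0)
  have hhpos : (0 : ℚ) < h := by exact_mod_cast (by omega : 0 < h)
  have hq : ∑ i, (lam i : ℚ) = h := by exact_mod_cast hh.symm
  have hlpos : ∀ i, (0 : ℚ) < lam i := fun i => by exact_mod_cast hpos i
  set v : Fin (n + 1) → Fin n → ℚ := fun i j => (ρ i j : ℚ) with hv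
  have hspan : Submodule.span ℚ (Set.range v) = ⊤ := span_rat_eq_top_of_span_int hgen
  have hrel : ∑ i, (lam i : ℚ) • v i = 0 := by
    ext j
    have hj := congrArg (Int.cast : ℤ → ℚ) (congrFun hzero j)
    simpa [Finset.sum_apply] using hj
  have hw1 : ∑ i, (lam i : ℚ) / h = 1 := by rw [← Finset.sum_div, hq, div_self hne]
  have hw0 : ∑ i, ((lam i : ℚ) / h) • v i = 0 := by
    simp_rw [div_eq_inv_mul, mul_smul]
    rw [← Finset.smul_sum, hrel, smul_zero]
  have hlam0 : (fun i => (lam i : ℚ)) ≠ 0 := fun hz => (hlpos 0).ne' (congrFun hz 0)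
  have hint : ∀ x, x ∈ interior P ↔ _ := fun x => hP ▸
    mem_interior_convexHull_range_iff hspan (fun i => div_pos (hlpos i) hhpos) hw1 hw0 x
  have hlt : ∀ b : Fin (n + 1) → ℚ, (∀ i, 0 < b i) → ∀ i, b i < ∑ k, b k := by
    intro b hb i
    have : Nontrivial (Fin (n + 1)) := Fin.nontrivial_iff_two_le.2 (by omega)
    obtain ⟨k, hk⟩ := exists_ne i
    exact Finset.single_lt_sum hk (Finset.mem_univ i) (Finset.mem_univ k) (hb k)
      fun j _ _ => (hb j).le
  constructor
  · intro hcan κ hκ2 hκh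
    obtain ⟨z, hz⟩ := exists_sum_fract_eq_intCast (by omega) hh κ
    constructor
    · rw [hz]
      have hz0 : (0 : ℚ) ≤ z := hz ▸ Finset.sum_nonneg fun i _ => Int.fract_nonneg _
      have hzne : z ≠ 0 := by
        rintro rfl
        rw [Int.cast_zero, Finset.sum_eq_zero_iff_of_nonneg fun i _ => Int.fract_nonneg _] at hz
        have hdvd : (h : ℤ) ∣ κ := dvd_of_forall_mul_div_eq_intCast hgcd (by omega) fun i => by
          obtain ⟨y, hy⟩ := Int.fract_eq_zero_iff.1 (hz i (Finset.mem_univ i))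
          exact ⟨y, hy.symm⟩
        have := Int.le_of_dvd (by omega) hdvd
        omega
      have : (0 : ℤ) ≤ z := by exact_mod_cast hz0
      exact_mod_cast (by omega : (1 : ℤ) ≤ z)
    · by_contra! hgt
      have hzn : (n : ℚ) ≤ z := by
        rw [hz] at hgt
        have : (n : ℤ) - 1 < z := by exact_mod_cast hgt
        exact_mod_cast (by omega : (n : ℤ) ≤ z)
      set b : Fin (n + 1) → ℚ := fun i => 1 - Int.fract ((lam i : ℚ) * κ / h) with hb
      have hbpos : ∀ i, 0 < b i := fun i => sub_pos.2 (Int.fract_lt_one _)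
      have hbsum : ∑ i, b i = n + 1 - z := by simp [hb, Finset.sum_sub_distrib, hz]
      have hb1 : ∑ i, b i = 1 := by
        have hp : 0 < ∑ i, b i := Finset.sum_pos (fun i _ => hbpos i) Finset.univ_nonempty
        rw [hbsum] at hp ⊢
        have h1 : z < n + 1 := by exact_mod_cast sub_pos.1 hp
        have h2 : (n : ℤ) ≤ z := by exact_mod_cast hzn
        have h3 : z = n := by omega
        rw [h3]
        push_cast
        ring
      have hfloor : ∀ i, b i = (⌊(lam i : ℚ) * κ / h⌋ + 1 : ℤ) - (κ / h) * lam i := by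
        intro i
        simp only [hb, Int.fract]
        push_cast
        ring
      have hmem : ∑ i, b i • v i ∈ ({0} : Set (Fin n → ℚ)) := by
        rw [← hcan]
        refine ⟨(hint _).2 ⟨b, hbpos, hb1, rfl⟩, fun j =>
          ⟨∑ i, (⌊(lam i : ℚ) * κ / h⌋ + 1) * ρ i j, ?_⟩⟩
        have hj := congrFun hrel j
        simp only [Finset.sum_apply, Pi.smul_apply, smul_eq_mul, Pi.zero_apply] at hj
        simp only [Finset.sum_apply, Pi.smul_apply, smul_eq_mul, hfloor, sub_mul, mul_assoc,
          Finset.sum_sub_distrib, ← Finset.mul_sum, hj]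
        simp [hv]
      obtain ⟨t, ht⟩ := exists_eq_smul_of_relation hspan hlam0 hrel hmem
      have hth : t * h = 1 := by
        rw [← hb1, ← hq, Finset.mul_sum]
        exact Finset.sum_congr rfl fun i _ => (ht i).symm
      have hdvd : (h : ℤ) ∣ κ + 1 := dvd_of_forall_mul_div_eq_intCast hgcd (by omega) fun i => by
        refine ⟨⌊(lam i : ℚ) * κ / h⌋ + 1, ?_⟩
        have h1 := hfloor i
        rw [ht i, eq_div_of_mul_eq hne hth] at h1
        rw [← add_eq_of_eq_sub h1]
        push_cast
        ring
      have := Int.le_of_dvd (by omega) hdvd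
      omega
  · intro hcond
    refine Set.eq_singleton_iff_unique_mem.2 ⟨⟨(hint 0).2
      ⟨_, fun i => div_pos (hlpos i) hhpos, hw1, hw0⟩, fun j => ⟨0, by simp⟩⟩, ?_⟩
    rintro x ⟨hx, hxZ⟩
    obtain ⟨b, hb, hb1, hbx⟩ := (hint x).1 hx
    have hblt : ∀ i, b i < 1 := fun i => hb1 ▸ hlt b hb i
    choose y hy using hxZ
    obtain ⟨m, hm⟩ := (Submodule.mem_span_range_iff_exists_fun ℤ (x := y)).1
      (hgen ▸ Submodule.mem_top)
    have hmx : ∑ i, (m i : ℚ) • v i = x := by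
      ext j
      have hj := congrArg (Int.cast : ℤ → ℚ) (congrFun hm j)
      rw [hy j, ← hj]
      simp [Finset.sum_apply, hv]
    obtain ⟨t, ht⟩ := exists_eq_smul_of_relation (c := fun i => b i - m i) hspan hlam0 hrel (by
      simp_rw [sub_smul]
      rw [Finset.sum_sub_distrib, hbx, hmx, sub_self])
    have hth : 1 - ((∑ i, m i : ℤ) : ℚ) = t * h := by
      rw [← hb1, ← hq, Finset.mul_sum, Int.cast_sum, ← Finset.sum_sub_distrib]
      exact Finset.sum_congr rfl fun i _ => ht i
    set κ : ℤ := (∑ i, m i - 1) % h with hκ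
    have hκ0 : 0 ≤ κ := Int.emod_nonneg _ (by omega)
    have hκh : κ < h := Int.emod_lt_of_pos _ (by omega)
    obtain ⟨q, hκq⟩ : ∃ q : ℤ, (κ : ℚ) = -(t * h) - h * q := by
      refine ⟨(∑ i, m i - 1) / h, ?_⟩
      rw [← hth, hκ, Int.emod_def]
      push_cast
      ring
    have hfract : ∀ i, Int.fract ((lam i : ℚ) * κ / h) = 1 - b i := by
      intro i
      refine Int.fract_eq_iff.2 ⟨sub_nonneg.2 (hblt i).le, by linarith [hb i],
        m i - 1 - lam i * q, ?_⟩
      have h1 : (lam i : ℚ) * κ / h = -(t * lam i) - lam i * q := by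
        rw [hκq]
        field_simp
      rw [h1, ← ht i]
      push_cast
      ring
    have hF : ∑ i, Int.fract ((lam i : ℚ) * κ / h) = n := by
      simp_rw [hfract]
      simp [Finset.sum_sub_distrib, hb1]
    have hκlast : κ = h - 1 := by
      by_contra hκne
      by_cases hκ2 : 2 ≤ κ
      · have := (hcond κ hκ2 (by omega)).2
        rw [hF] at this
        linarith
      obtain hκ | hκ : κ = 0 ∨ κ = 1 := by omega
      · have := hfract 0
        simp only [hκ, Int.cast_zero, mul_zero, zero_div, Int.fract_zero] at this
        linarith [hblt 0]
      · have hsmall : ∀ i, Int.fract ((lam i : ℚ) * κ / h) = lam i / h := by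
          intro i
          rw [hκ, Int.cast_one, mul_one, Int.fract_eq_self]
          exact ⟨(div_pos (hlpos i) hhpos).le, (div_lt_one hhpos).2 (hq ▸ hlt _ hlpos i)⟩
        have hn1 : n = 1 := by
          simp_rw [hsmall, hw1] at hF
          exact_mod_cast hF.symm
        subst hn1
        have h0 := hwf 0
        have h1 := hwf 1
        rw [show (Finset.univ.erase (0 : Fin (1 + 1))) = {1} from by decide] at h0
        rw [show (Finset.univ.erase (1 : Fin (1 + 1))) = {0} from by decide] at h1
        simp only [Finset.gcd_singleton, normalize_eq] at h0 h1
        rw [Fin.sum_univ_two, h0, h1] at hh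
        omega
    have hdiff : ∀ i, b i = lam i / h := by
      intro i
      have hfi : Int.fract ((lam i : ℚ) * κ / h) = 1 - lam i / h := by
        refine Int.fract_eq_iff.2 ⟨sub_nonneg.2 ((div_le_one hhpos).2 (hq ▸ (hlt _ hlpos i).le)),
          by linarith [div_pos (hlpos i) hhpos], lam i - 1, ?_⟩
        rw [hκlast]
        push_cast
        field_simp
        ring
      linarith [hfract i]
    rw [← hbx, ← hw0]
    exact Finset.sum_congr rfl fun i _ => by rw [hdiff i]
end

section
/- Let (λ_0,…,λ_n) be a well-formed tuple of positive integers with gcd(λ_0,…,λ_n) = 1, let h = λ_0 + ⋯ + λ_n, and let P = conv{ρ_0,…,ρ_n} ⊆ ℚ^n be an associated simplex. Fix an index j with λ_j ∣ h, and let F_j = conv{ρ_0,…,ρ_{j−1}, ρ_{j+1},…,ρ_n} be the facet of P not containing ρ_j. Then conv(F_j ∪ {0}) ∩ ℤ^n = (F_j ∩ ℤ^n) ∪ {0}; that is, the only lattice point of the cone over F_j truncated at F_j that does not lie on F_j itself is the origin. -/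
/-- If integer vectors span `ℤⁿ`, every rational vector is a rational combination of them. -/
theorem linearCombination_intCast_surjective {ι : Type*} [Fintype ι] {n : ℕ}
    (ρ : ι → Fin n → ℤ) (hgen : Submodule.span ℤ (Set.range ρ) = ⊤) :
    Function.Surjective (Fintype.linearCombination ℚ (fun i k => (ρ i k : ℚ))) := by
  have hsingle (k : Fin n) : ∃ c : ι → ℤ, ∑ i, c i • ρ i = Pi.single k 1 :=
    Submodule.mem_span_range_iff_exists_fun ℤ |>.1 (hgen ▸ Submodule.mem_top)
  choose c hc using hsingle
  intro x
  refine ⟨fun i => ∑ k, x k * c k i, ?_⟩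
  ext l
  have hl (k : Fin n) : ∑ i, (c k i : ℚ) * ρ i l = (Pi.single k 1 : Fin n → ℚ) l := by
    have h := congrFun (hc k) l
    simp only [Finset.sum_apply, Pi.smul_apply, smul_eq_mul, Pi.single_apply] at h
    rw [Pi.single_apply]
    exact_mod_cast h
  simp only [Fintype.linearCombination_apply, Finset.sum_apply, Pi.smul_apply, smul_eq_mul,
    Finset.sum_mul]
  rw [Finset.sum_comm]
  simp_rw [mul_assoc, ← Finset.mul_sum, hl, Pi.single_apply]
  simp

/-- The linear relations among `n + 1` vectors spanning an `n`-dimensional space are all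
proportional to any given nonzero relation. -/
theorem exists_smul_eq_of_linearCombination_eq_zero {n : ℕ} {v : Fin (n + 1) → Fin n → ℚ}
    (hv : Function.Surjective (Fintype.linearCombination ℚ v)) {w u : Fin (n + 1) → ℚ}
    (hw0 : w ≠ 0) (hw : Fintype.linearCombination ℚ v w = 0)
    (hu : Fintype.linearCombination ℚ v u = 0) : ∃ t : ℚ, t • w = u := by
  have hrank := (Fintype.linearCombination ℚ v).finrank_range_add_finrank_ker
  rw [LinearMap.range_eq_top.2 hv, finrank_top, Module.finrank_fin_fun,
    Module.finrank_fin_fun] at hrank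
  have hker : Module.finrank ℚ (LinearMap.ker (Fintype.linearCombination ℚ v)) = 1 := by omega
  have hw0' : (⟨w, hw⟩ : LinearMap.ker (Fintype.linearCombination ℚ v)) ≠ 0 := by
    simpa [Subtype.ext_iff] using hw0
  obtain ⟨t, ht⟩ := (finrank_eq_one_iff_of_nonzero' _ hw0').1 hker ⟨u, hu⟩
  exact ⟨t, congrArg Subtype.val ht⟩

/-- Points of the convex hull of a facet and the origin are subconvex combinations of the
vertices of the facet. -/
theorem exists_coeff_of_mem_convexHull_facet_union_zero {ι E : Type*} [Fintype ι]
    [AddCommGroup E] [Module ℚ E] (v : ι → E) (j : ι) {x : E}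
    (hx : x ∈ convexHull ℚ (convexHull ℚ (v '' {i | i ≠ j}) ∪ {0})) :
    ∃ c : ι → ℚ, (∀ i, 0 ≤ c i) ∧ c j = 0 ∧ ∑ i, c i ≤ 1 ∧
      Fintype.linearCombination ℚ v c = x := by
  classical
  let C : Set (ι → ℚ) := {c | (∀ i, 0 ≤ c i) ∧ c j = 0 ∧ ∑ i, c i ≤ 1}
  have hC : Convex ℚ C := by
    rintro c ⟨hc, hcj, hcs⟩ d ⟨hd, hdj, hds⟩ a b ha hb hab
    refine ⟨fun i => ?_, by simp [hcj, hdj], ?_⟩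
    · have := mul_nonneg ha (hc i)
      have := mul_nonneg hb (hd i)
      simp only [Pi.add_apply, Pi.smul_apply, smul_eq_mul]
      positivity
    · simp only [Pi.add_apply, Pi.smul_apply, smul_eq_mul, Finset.sum_add_distrib,
        ← Finset.mul_sum]
      nlinarith
  have hTC := hC.linear_image (Fintype.linearCombination ℚ v)
  have hsub : convexHull ℚ (convexHull ℚ (v '' {i | i ≠ j}) ∪ {0}) ⊆
      Fintype.linearCombination ℚ v '' C := by
    refine convexHull_min (Set.union_subset (convexHull_min ?_ hTC) ?_) hTC
    · rintro _ ⟨i, hi, rfl⟩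
      refine ⟨Pi.single i 1, ⟨fun k => ?_, ?_, ?_⟩, by simp⟩
      · rw [Pi.single_apply]; split_ifs <;> norm_num
      · exact Pi.single_eq_of_ne (Ne.symm hi) _
      · simp
    · rintro _ rfl
      exact ⟨0, ⟨by simp, by simp, by simp⟩, by simp⟩
  obtain ⟨c, ⟨h0, hj, h1⟩, hcx⟩ := hsub hx
  exact ⟨c, h0, hj, h1, hcx⟩

/-- A rational relation presenting a lattice point without using the vertex `ρ j` has integral
coefficient sum, provided `λ j` divides the sum of the weights. -/
theorem exists_int_eq_sum_coeff {n : ℕ} {lam : Fin (n + 1) → ℕ} {ρ : Fin (n + 1) → Fin n → ℤ}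
    (hgen : Submodule.span ℤ (Set.range ρ) = ⊤) (hzero : ∑ i, (lam i : ℤ) • ρ i = 0)
    {j : Fin (n + 1)} (hj : 0 < lam j) (hdvd : lam j ∣ ∑ i, lam i)
    {c : Fin (n + 1) → ℚ} (hcj : c j = 0) (z : Fin n → ℤ)
    (hc : Fintype.linearCombination ℚ (fun i k => (ρ i k : ℚ)) c = fun k => (z k : ℚ)) :
    ∃ m : ℤ, ∑ i, c i = m := by
  have hcast (a : Fin (n + 1) → ℤ) :
      Fintype.linearCombination ℚ (fun i k => (ρ i k : ℚ)) (fun i => (a i : ℚ)) =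
        fun k => (((∑ i, a i • ρ i) k : ℤ) : ℚ) := by
    ext k
    simp [Fintype.linearCombination_apply]
  obtain ⟨a, ha⟩ := Submodule.mem_span_range_iff_exists_fun ℤ |>.1
    (hgen ▸ Submodule.mem_top : z ∈ Submodule.span ℤ (Set.range ρ))
  have hjQ : (lam j : ℚ) ≠ 0 := by exact_mod_cast hj.ne'
  have hw : Fintype.linearCombination ℚ (fun i k => (ρ i k : ℚ)) (fun i => (lam i : ℚ)) = 0 := by
    ext k
    have hk := congrFun (hcast fun i => (lam i : ℤ)) k
    rw [hzero] at hk
    simpa only [Pi.zero_apply, Int.cast_zero, Int.cast_natCast] using hk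
  obtain ⟨t, ht⟩ := exists_smul_eq_of_linearCombination_eq_zero
    (linearCombination_intCast_surjective ρ hgen)
    (fun h0 => hjQ (congrFun h0 j)) hw
    (u := c - fun i => (a i : ℚ)) (by rw [map_sub, hc, hcast, ha, sub_self])
  have hti (i) : c i = a i + t * lam i := by
    have := congrFun ht i
    simp only [Pi.smul_apply, smul_eq_mul, Pi.sub_apply] at this
    linarith
  obtain ⟨q, hq⟩ := hdvd
  have hqQ : ∑ i, (lam i : ℚ) = lam j * q := by exact_mod_cast hq
  refine ⟨∑ i, a i - a j * q, ?_⟩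
  simp_rw [hti, Finset.sum_add_distrib, ← Finset.mul_sum, hqQ]
  have htj := hti j
  rw [hcj] at htj
  push_cast
  linear_combination -(q : ℚ) * htj


/-- **Corollary 2.6.** Let `(λ₀,…,λₙ)` be well-formed weights with `gcd = 1`,
`h = λ₀ + ⋯ + λₙ`, and let `P = conv{ρ₀,…,ρₙ} ⊆ ℚⁿ` be an associated simplex. If
`λⱼ ∣ h` and `F_j` is the facet of `P` not containing `ρⱼ`, then
`conv(F_j ∪ {0}) ∩ ℤⁿ = (F_j ∩ ℤⁿ) ∪ {0}`. -/
theorem stmt_3 (n : ℕ) (lam : Fin (n + 1) → ℕ)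
    (hpos : ∀ i, 0 < lam i)
    (hgcd : Finset.univ.gcd lam = 1)
    (hwf : ∀ i : Fin (n + 1), (Finset.univ.erase i).gcd lam = 1)
    (h : ℕ) (hh : h = ∑ i, lam i)
    (ρ : Fin (n + 1) → Fin n → ℤ)
    (hprim : ∀ i, Finset.univ.gcd (ρ i) = 1)
    (hgen : Submodule.span ℤ (Set.range ρ) = ⊤)
    (hzero : ∑ i, (lam i : ℤ) • ρ i = 0)
    (j : Fin (n + 1)) (hdvd : lam j ∣ h)
    (F : Set (Fin n → ℚ))
    (hF : F = convexHull ℚ ((fun i => fun k => (ρ i k : ℚ)) '' {i | i ≠ j})) :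
    {x | x ∈ convexHull ℚ (F ∪ {0}) ∧ ∀ k, ∃ z : ℤ, x k = (z : ℚ)}
      = {x | x ∈ F ∧ ∀ k, ∃ z : ℤ, x k = (z : ℚ)} ∪ {0} := by
  subst hF hh
  ext x
  constructor
  · rintro ⟨hx, hz⟩
    obtain ⟨c, hc0, hcj, hc1, hcx⟩ := exists_coeff_of_mem_convexHull_facet_union_zero _ j hx
    choose z hz' using hz
    obtain ⟨m, hm⟩ := exists_int_eq_sum_coeff hgen hzero (hpos j) hdvd hcj z
      (hcx.trans (funext hz'))
    have hm0 : (0 : ℤ) ≤ m := by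
      exact_mod_cast hm ▸ Finset.sum_nonneg fun i _ => hc0 i
    have hm1 : m ≤ 1 := by exact_mod_cast hm ▸ hc1
    obtain rfl | rfl : m = 0 ∨ m = 1 := by omega
    · right
      have hc : c = 0 := funext fun i =>
        (Finset.sum_eq_zero_iff_of_nonneg fun i _ => hc0 i).1 (by simpa using hm) i
          (Finset.mem_univ i)
      simp [← hcx, hc]
    · left
      refine ⟨?_, fun k => ⟨z k, hz' k⟩⟩
      rw [← hcx, Fintype.linearCombination_apply,
        ← Finset.sum_erase (a := j) _ (by rw [hcj, zero_smul])]
      refine (convex_convexHull ℚ _).sum_mem (fun i _ => hc0 i) ?_ fun i hi =>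
        subset_convexHull ℚ _ ⟨i, Finset.ne_of_mem_erase hi, rfl⟩
      rw [Finset.sum_erase _ hcj, hm, Int.cast_one]
  · rintro (⟨hx, hz⟩ | rfl)
    · exact ⟨subset_convexHull ℚ _ (Or.inl hx), hz⟩
    · exact ⟨subset_convexHull ℚ _ (Or.inr rfl), fun _ => ⟨0, by simp⟩⟩
end

section
/- Let (λ_0,…,λ_n) be a well-formed tuple of positive integers with gcd(λ_0,…,λ_n) = 1 and h = λ_0 + ⋯ + λ_n, such that gcd(λ_i, h) = 1 for every i, and such that for every integer κ with 2 ≤ κ ≤ h − 2 one has 1 ≤ Σ_{i=0}^n {λ_i κ / h} ≤ n − 1 (the canonical condition). Then: (a) for every integer κ with 2 ≤ κ ≤ h − 2 in fact 2 ≤ Σ_{i=0}^n {λ_i κ / h} ≤ n − 1 (the terminal condition holds); and (b) the δ-vector is shifted palindromic, i.e. with δ_j := #{κ ∈ {0,1,…,h−1} : Σ_{i=0}^n {λ_i κ / h} = j} one has δ_0 = 1 and δ_j = δ_{n+1−j} for all j ∈ {1,…,n}. -/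
/-- The Ehrhart `δ`-vector of the simplex associated with weights `lam` summing to `h`:
`δ_j` counts the `κ ∈ {0,…,h−1}` with `Σᵢ {λᵢκ/h} = j`. -/
def deltaVec (n h : ℕ) (lam : Fin (n + 1) → ℕ) (j : ℕ) : ℕ :=
  ((Finset.range h).filter fun κ : ℕ =>
    (∑ i, Int.fract ((lam i : ℚ) * (κ : ℚ) / (h : ℚ))) = (j : ℚ)).card

theorem fract_mul_div_pos {l h : ℕ} (hpos : 0 < h) (hc : Nat.Coprime l h) {k : ℤ}
    (hk : ¬ (h : ℤ) ∣ k) : 0 < Int.fract ((l : ℚ) * (k : ℚ) / (h : ℚ)) := by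
  refine lt_of_le_of_ne (Int.fract_nonneg _) fun h0 => hk ?_
  obtain ⟨z, hz⟩ := Int.fract_eq_zero_iff.mp h0.symm
  have hq : (h : ℚ) ≠ 0 := by positivity
  rw [eq_div_iff hq] at hz
  have hz' : z * (h : ℤ) = l * k := by exact_mod_cast hz
  have hd : (h : ℤ) ∣ l * k := ⟨z, by rw [← hz', mul_comm]⟩
  exact IsCoprime.dvd_of_dvd_mul_left (Nat.isCoprime_iff_coprime.mpr hc.symm) hd

theorem fract_mul_sub_div {l h : ℕ} (hpos : 0 < h) (hc : Nat.Coprime l h) {k : ℤ}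
    (hk : ¬ (h : ℤ) ∣ k) :
    Int.fract ((l : ℚ) * (((h : ℤ) - k : ℤ) : ℚ) / (h : ℚ)) =
      1 - Int.fract ((l : ℚ) * (k : ℚ) / (h : ℚ)) := by
  have hq : (h : ℚ) ≠ 0 := by positivity
  have he : (l : ℚ) * (((h : ℤ) - k : ℤ) : ℚ) / (h : ℚ) = -((l : ℚ) * k / h) + (l : ℕ) := by
    push_cast
    field_simp
    ring
  rw [he, Int.fract_add_natCast, Int.fract_neg (fract_mul_div_pos hpos hc hk).ne']

theorem sum_fract_mul_sub_div {n h : ℕ} {lam : Fin (n + 1) → ℕ} (hpos : 0 < h)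
    (hc : ∀ i, Nat.Coprime (lam i) h) {k : ℤ} (hk : ¬ (h : ℤ) ∣ k) :
    ∑ i, Int.fract ((lam i : ℚ) * (((h : ℤ) - k : ℤ) : ℚ) / (h : ℚ)) =
      n + 1 - ∑ i, Int.fract ((lam i : ℚ) * (k : ℚ) / (h : ℚ)) := by
  rw [Finset.sum_congr rfl fun i _ => fract_mul_sub_div hpos (hc i) hk]
  simp

theorem not_natCast_dvd_of_pos_of_lt {h : ℕ} {k : ℤ} (h0 : 0 < k) (h1 : k < h) :
    ¬ (h : ℤ) ∣ k := fun hd => by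
  have := Int.le_of_dvd h0 hd
  omega

theorem deltaVec_zero {n h : ℕ} {lam : Fin (n + 1) → ℕ} (hpos : 0 < h)
    (hc : ∀ i, Nat.Coprime (lam i) h) : deltaVec n h lam 0 = 1 := by
  rw [deltaVec, Finset.card_eq_one]
  refine ⟨0, Finset.ext fun k => ?_⟩
  simp only [Finset.mem_filter, Finset.mem_range, Finset.mem_singleton]
  constructor
  · rintro ⟨hk, hs⟩
    by_contra hk0
    have hnd : ¬ (h : ℤ) ∣ (k : ℤ) := not_natCast_dvd_of_pos_of_lt (by omega) (by omega)
    have : 0 < ∑ i, Int.fract ((lam i : ℚ) * (k : ℚ) / (h : ℚ)) :=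
      Finset.sum_pos (fun i _ => by
        simpa only [Int.cast_natCast] using fract_mul_div_pos hpos (hc i) hnd)
        Finset.univ_nonempty
    rw [hs] at this
    simp at this
  · rintro rfl
    simpa using hpos

theorem deltaVec_symm {n h : ℕ} {lam : Fin (n + 1) → ℕ} (hpos : 0 < h)
    (hc : ∀ i, Nat.Coprime (lam i) h) {j : ℕ} (hj : 1 ≤ j) (hjn : j ≤ n) :
    deltaVec n h lam j = deltaVec n h lam (n + 1 - j) := by
  have key : ∀ j : ℕ, 1 ≤ j → j ≤ n → ∀ k ∈ (Finset.range h).filter (fun κ : ℕ =>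
      (∑ i, Int.fract ((lam i : ℚ) * (κ : ℚ) / (h : ℚ))) = (j : ℚ)),
      0 < k ∧ k < h ∧ h - k ∈ (Finset.range h).filter (fun κ : ℕ =>
      (∑ i, Int.fract ((lam i : ℚ) * (κ : ℚ) / (h : ℚ))) = ((n + 1 - j : ℕ) : ℚ)) := by
    intro j hj hjn k hk
    rw [Finset.mem_filter, Finset.mem_range] at hk
    obtain ⟨hkh, hs⟩ := hk
    have hk0 : 0 < k := by
      rcases Nat.eq_zero_or_pos k with rfl | hk0
      · have : (0 : ℚ) = j := by simpa using hs
        have : 0 = j := by exact_mod_cast this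
        omega
      · exact hk0
    refine ⟨hk0, hkh, ?_⟩
    rw [Finset.mem_filter, Finset.mem_range]
    refine ⟨by omega, ?_⟩
    have hsum := sum_fract_mul_sub_div (k := (k : ℤ)) hpos hc
      (not_natCast_dvd_of_pos_of_lt (by omega) (by omega))
    rw [Int.cast_natCast, hs] at hsum
    rw [Nat.cast_sub (by omega : j ≤ n + 1), Nat.cast_sub hkh.le]
    push_cast at hsum ⊢
    exact hsum
  refine Finset.card_bij' (fun k _ => h - k) (fun k _ => h - k)
    (fun k hk => (key j hj hjn k hk).2.2) (fun k hk => ?_) (fun k hk => ?_) (fun k hk => ?_)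
  · have := (key (n + 1 - j) (by omega) (by omega) k hk).2.2
    rwa [Nat.sub_sub_self (by omega : j ≤ n + 1)] at this
  · exact Nat.sub_sub_self (key j hj hjn k hk).2.1.le
  · exact Nat.sub_sub_self (key (n + 1 - j) (by omega) (by omega) k hk).2.1.le


/-- **Corollary 2.9.** If the well-formed weights `(λ₀,…,λₙ)` satisfy `gcd(λᵢ, h) = 1`
for all `i` and the canonical condition, then the terminal condition holds, and the
`δ`-vector is shifted palindromic: `δ₀ = 1` and `δ_j = δ_{n+1−j}` for `j ∈ {1,…,n}`. -/
theorem stmt_4 (n : ℕ) (lam : Fin (n + 1) → ℕ)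
    (hpos : ∀ i, 0 < lam i)
    (hgcd : Finset.univ.gcd lam = 1)
    (hwf : ∀ i : Fin (n + 1), (Finset.univ.erase i).gcd lam = 1)
    (h : ℕ) (hh : h = ∑ i, lam i)
    (hcop : ∀ i, Nat.Coprime (lam i) h)
    (hcanon : ∀ κ : ℤ, 2 ≤ κ → κ ≤ (h : ℤ) - 2 →
      1 ≤ ∑ i, Int.fract ((lam i : ℚ) * (κ : ℚ) / (h : ℚ)) ∧
        ∑ i, Int.fract ((lam i : ℚ) * (κ : ℚ) / (h : ℚ)) ≤ (n : ℚ) - 1) :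
    (∀ κ : ℤ, 2 ≤ κ → κ ≤ (h : ℤ) - 2 →
      2 ≤ ∑ i, Int.fract ((lam i : ℚ) * (κ : ℚ) / (h : ℚ)) ∧
        ∑ i, Int.fract ((lam i : ℚ) * (κ : ℚ) / (h : ℚ)) ≤ (n : ℚ) - 1) ∧
    deltaVec n h lam 0 = 1 ∧
    (∀ j : ℕ, 1 ≤ j → j ≤ n → deltaVec n h lam j = deltaVec n h lam (n + 1 - j)) := by
  have hpos' : 0 < h := by
    rw [hh]
    exact Finset.sum_pos (fun i _ => hpos i) Finset.univ_nonempty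
  refine ⟨fun κ h2 hκ => ⟨?_, (hcanon κ h2 hκ).2⟩, deltaVec_zero hpos' hcop,
    fun j hj hjn => deltaVec_symm hpos' hcop hj hjn⟩
  have hle := (hcanon (h - κ) (by omega) (by omega)).2
  rw [sum_fract_mul_sub_div hpos' hcop
    (not_natCast_dvd_of_pos_of_lt (by omega) (by omega))] at hle
  linarith
end

section
/- Let (λ_0,λ_1,λ_2,λ_3,λ_4) be a well-formed tuple of positive integers with gcd equal to 1 and h = λ_0 + ⋯ + λ_4, such that λ_i ∣ h for every i, and such that for every integer κ with 2 ≤ κ ≤ h − 2 one has 2 ≤ Σ_{i=0}^4 {λ_i κ / h} ≤ 3 (i.e. the Gorenstein weighted projective space ℙ(λ_0,…,λ_4) is terminal). Then, up to permutation, (λ_0,λ_1,λ_2,λ_3,λ_4) equals (1,1,1,1,1) or (1,1,1,1,2). -/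
/-- If `h = y l`, then the fractional part of `l k / h` is `k / y - ⌊k / y⌋`. -/
lemma fract_mul_div_eq_sub {l y h : ℕ} (hl : 0 < l) (hy : h = l * y) (k : ℕ) :
    Int.fract ((l : ℚ) * ((k : ℤ) : ℚ) / (h : ℚ)) = (l : ℚ) * k / h - ((k / y : ℕ) : ℚ) := by
  have hl' : (l : ℚ) ≠ 0 := by positivity
  have e : (l : ℚ) * k / h = (k : ℚ) / y := by
    rw [hy]
    push_cast
    exact mul_div_mul_left _ _ hl'
  rw [Int.cast_natCast, e, Int.fract, Rat.floor_natCast_div_natCast]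
  norm_cast

/-- For weights `l i` with sum `h` and `h = l i * y i`, the fractional parts of `l i * k / h` add up
to `k - ∑ i, ⌊k / y i⌋`. -/
lemma sum_fract_mul_div_eq_sub {ι : Type*} [Fintype ι] {l y : ι → ℕ} {h : ℕ} (hpos : ∀ i, 0 < l i)
    (h0 : h ≠ 0) (hh : h = ∑ i, l i) (hy : ∀ i, h = l i * y i) (k : ℕ) :
    ∑ i, Int.fract ((l i : ℚ) * ((k : ℤ) : ℚ) / (h : ℚ)) = k - ((∑ i, k / y i : ℕ) : ℚ) := by
  have h0' : (h : ℚ) ≠ 0 := by exact_mod_cast h0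
  simp_rw [fun i => fract_mul_div_eq_sub (hpos i) (hy i) k]
  rw [Finset.sum_sub_distrib, ← Finset.sum_div, ← Finset.sum_mul, ← Nat.cast_sum, ← hh,
    mul_div_cancel_left₀ _ h0', ← Nat.cast_sum]

lemma le_of_mul_eq_of_lt_mul {l y h N : ℕ} (hy : h = l * y) (hN : h < l * (N + 1)) : y ≤ N := by
  rw [hy] at hN
  exact Nat.lt_succ_iff.mp (lt_of_mul_lt_mul_left hN (Nat.zero_le _))

lemma le_of_mul_eq_mul_of_le {a b x y : ℕ} (ha : 0 < a) (hab : a ≤ b) (h : a * x = b * y) :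
    y ≤ x := by
  by_contra! hlt
  nlinarith

lemma mul_le_of_eq_mul {l y h N : ℕ} (hy : h = l * y) (hN : N ≤ y) : l * N ≤ h :=
  hy ▸ Nat.mul_le_mul_left l hN

set_option maxHeartbeats 1600000 in
/-- There is no decomposition of `h ≥ 8` as a sum of five divisors that satisfies the terminality
condition; here the divisors `a ≤ b ≤ c ≤ d ≤ e` have the cofactors `v, w, x, y, z`. -/
lemma not_terminal_of_eight_le {a b c d e v w x y z h : ℕ} (ha : 0 < a)
    (hab : a ≤ b) (hbc : b ≤ c) (hcd : c ≤ d) (hde : d ≤ e) (hh : h = a + b + c + d + e)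
    (hv : h = a * v) (hw : h = b * w) (hx : h = c * x) (hy : h = d * y) (hz : h = e * z)
    (h8 : 8 ≤ h)
    (hterm : ∀ k : ℕ, 2 ≤ k → k + 2 ≤ h →
      k / v + k / w + k / x + k / y + k / z + 2 ≤ k ∧
        k ≤ k / v + k / w + k / x + k / y + k / z + 3) : False := by
  have hwv : w ≤ v := le_of_mul_eq_mul_of_le ha hab (hv ▸ hw)
  have hxw : x ≤ w := le_of_mul_eq_mul_of_le (by omega) hbc (hw ▸ hx)
  have hyx : y ≤ x := le_of_mul_eq_mul_of_le (by omega) hcd (hx ▸ hy)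
  have hzy : z ≤ y := le_of_mul_eq_mul_of_le (by omega) hde (hy ▸ hz)
  have hz0 : 0 < z := Nat.pos_of_ne_zero (by rintro rfl; omega)
  have t2 := (hterm 2 (by omega) (by omega)).1
  have t3 := (hterm 3 (by omega) (by omega)).1
  have t4 := (hterm 4 (by omega) (by omega)).1
  have t5 := (hterm 5 (by omega) (by omega)).1
  have t6 := (hterm 6 (by omega) (by omega)).1
  have t8 := hterm 8 (by omega)
  clear hterm
  have one_le_div {k u : ℕ} (hu : 0 < u) (huk : u ≤ k) : 1 ≤ k / u := Nat.div_pos huk hu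
  have hz3 : 3 ≤ z := by
    by_contra! hlt
    have := one_le_div (k := 2) hz0 (by omega)
    grind only
  have hy4 : 4 ≤ y := by
    by_contra! hlt
    have := one_le_div (k := 3) hz0 (by omega)
    have := one_le_div (k := 3) (u := y) (by omega) (by omega)
    grind only
  have hx5 : 5 ≤ x := by
    by_contra! hlt
    have := one_le_div (k := 4) hz0 (by omega)
    have := one_le_div (k := 4) (u := y) (by omega) (by omega)
    have := one_le_div (k := 4) (u := x) (by omega) (by omega)
    grind only
  have hw6 : 6 ≤ w := by
    by_contra! hlt
    have := one_le_div (k := 5) hz0 (by omega)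
    have := one_le_div (k := 5) (u := y) (by omega) (by omega)
    have := one_le_div (k := 5) (u := x) (by omega) (by omega)
    have := one_le_div (k := 5) (u := w) (by omega) (by omega)
    grind only
  have le_e := mul_le_of_eq_mul hz hz3
  have le_d := mul_le_of_eq_mul hy hy4
  have le_c := mul_le_of_eq_mul hx hx5
  have le_b := mul_le_of_eq_mul hw hw6
  have hz5 : z ≤ 5 := le_of_mul_eq_of_lt_mul hz (by omega)
  have hy6 : y ≤ 6 := le_of_mul_eq_of_lt_mul hy (by omega)
  have hx7 : x ≤ 7 := le_of_mul_eq_of_lt_mul hx (by omega)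
  have hw9 : w ≤ 9 := le_of_mul_eq_of_lt_mul hw (by omega)
  have hv20 : v ≤ 20 := le_of_mul_eq_of_lt_mul hv (by omega)
  clear t2 t3 t4 t5
  interval_cases z <;> interval_cases y <;> try omega
  all_goals interval_cases x <;> try omega
  all_goals interval_cases w <;> try omega
  all_goals interval_cases v <;> omega

theorem stmt_10 (lam : Fin 5 → ℕ)
    (hpos : ∀ i, 0 < lam i)
    (hgcd : Finset.univ.gcd lam = 1)
    (hwf : ∀ i : Fin 5, (Finset.univ.erase i).gcd lam = 1)
    (h : ℕ) (hh : h = ∑ i, lam i)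
    (hdvd : ∀ i, lam i ∣ h)
    (hterm : ∀ κ : ℤ, 2 ≤ κ → κ ≤ (h : ℤ) - 2 →
      2 ≤ ∑ i, Int.fract ((lam i : ℚ) * (κ : ℚ) / (h : ℚ)) ∧
        ∑ i, Int.fract ((lam i : ℚ) * (κ : ℚ) / (h : ℚ)) ≤ 3) :
    ∃ σ : Equiv.Perm (Fin 5),
      (fun i => lam (σ i)) = ![1, 1, 1, 1, 1] ∨
      (fun i => lam (σ i)) = ![1, 1, 1, 1, 2] := by
  choose v hv using hdvd
  let σ := Tuple.sort lam
  have hmono : Monotone (lam ∘ σ) := Tuple.monotone_sort lam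
  have h01 : lam (σ 0) ≤ lam (σ 1) := hmono (by decide)
  have h12 : lam (σ 1) ≤ lam (σ 2) := hmono (by decide)
  have h23 : lam (σ 2) ≤ lam (σ 3) := hmono (by decide)
  have h34 : lam (σ 3) ≤ lam (σ 4) := hmono (by decide)
  have hsum : h = lam (σ 0) + lam (σ 1) + lam (σ 2) + lam (σ 3) + lam (σ 4) := by
    rw [hh, ← Equiv.sum_comp σ, Fin.sum_univ_five]
  have p0 := hpos (σ 0)
  have hlt : h < 8 := by
    by_contra! h8
    refine not_terminal_of_eight_le p0 h01 h12 h23 h34 hsum (hv _) (hv _) (hv _) (hv _) (hv _)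
      h8 fun k hk hkh => ?_
    have t := hterm k (by omega) (by omega)
    rw [sum_fract_mul_div_eq_sub hpos (by omega) hh hv, ← Equiv.sum_comp σ, Fin.sum_univ_five] at t
    obtain ⟨t₁, t₂⟩ := t
    constructor
    · rw [le_sub_iff_add_le] at t₁
      norm_cast at t₁
      omega
    · rw [sub_le_iff_le_add] at t₂
      norm_cast at t₂
      omega
  have d4 : lam (σ 4) ∣ h := ⟨_, hv _⟩
  have d3 : lam (σ 3) ∣ h := ⟨_, hv _⟩
  refine ⟨σ, ?_⟩
  have key : lam (σ 0) = 1 ∧ lam (σ 1) = 1 ∧ lam (σ 2) = 1 ∧ lam (σ 3) = 1 ∧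
      (lam (σ 4) = 1 ∨ lam (σ 4) = 2) := by
    have : 5 ≤ h := by omega
    generalize lam (σ 3) = d at *
    generalize lam (σ 4) = e at *
    have : e ≤ 3 := by omega
    have : d ≤ 3 := by omega
    interval_cases h <;> interval_cases e <;> interval_cases d <;> omega
  obtain ⟨k0, k1, k2, k3, k4 | k4⟩ := key
  · left
    ext i
    fin_cases i <;> simp [k0, k1, k2, k3, k4]
  · right
    ext i
    fin_cases i <;> simp [k0, k1, k2, k3, k4]
end

section
/- Let (λ_0,…,λ_5) be a well-formed tuple of positive integers with gcd equal to 1 and h = λ_0 + ⋯ + λ_5, such that λ_i ∣ h for every i, and such that for every integer κ with 2 ≤ κ ≤ h − 2 one has 2 ≤ Σ_{i=0}^5 {λ_i κ / h} ≤ 4 (i.e. the Gorenstein weighted projective space ℙ(λ_0,…,λ_5) is terminal). Then, up to permutation, (λ_0,…,λ_5) equals one of (1,1,1,1,1,1), (1,1,1,1,2,2), (1,1,2,2,3,3), or (1,1,1,2,3,4). -/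
/-- The sum of the integer parts of `κ / a` over the entries `a` of a list. -/
def floorSum (l : List ℕ) (κ : ℕ) : ℕ := (l.map (κ / ·)).sum

/-- The least common multiple of the entries of a list. -/
def listLcm (l : List ℕ) : ℕ := l.foldr Nat.lcm 1

/-- The terminality condition, in terms of the denominators `a = h / λ`. -/
def TerminalDenoms (l : List ℕ) : Prop :=
  ∀ κ, 2 ≤ κ → κ + 2 ≤ listLcm l → κ ≤ floorSum l κ + 4 ∧ floorSum l κ + 2 ≤ κ

/-- Whether some `κ < 40` shows that no extension of `l` by entries at least `b` is terminal. -/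
def violates (l : List ℕ) (b : ℕ) : Bool :=
  (List.range 40).any fun κ =>
    decide (2 ≤ κ) && decide (κ + 2 ≤ listLcm l) &&
      (decide (κ < floorSum l κ + 2) || decide (κ < b) && decide (floorSum l κ + 4 < κ))

/-- The denominators of the four terminal weighted projective spaces. -/
def terminalLists : List (List ℕ) :=
  [[6, 6, 6, 6, 6, 6], [4, 4, 8, 8, 8, 8], [4, 4, 6, 6, 12, 12], [3, 4, 6, 12, 12, 12]]

/-- Exhaustive search over the extensions of `l` by `k` nondecreasing entries that are at least
`lo` and whose reciprocals sum to `n / d`. -/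
def search : ℕ → List ℕ → ℕ → ℕ → ℕ → Bool
  | 0, l, _, _, _ => violates l 40 || decide (l ∈ terminalLists)
  | k + 1, l, lo, n, d =>
    (List.range' lo ((k + 1) * d / n + 1 - lo)).all fun a =>
      decide (n * a < d) || violates (l ++ [a]) a ||
        search k (l ++ [a]) a (n * a - d) (d * a)

theorem floorSum_append (l m : List ℕ) (κ : ℕ) :
    floorSum (l ++ m) κ = floorSum l κ + floorSum m κ := by
  simp [floorSum]

theorem floorSum_eq_zero {l : List ℕ} {κ b : ℕ} (hl : ∀ x ∈ l, b ≤ x) (hκ : κ < b) :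
    floorSum l κ = 0 := by
  simp only [floorSum, List.sum_eq_zero_iff, List.mem_map]
  rintro _ ⟨x, hx, rfl⟩
  exact Nat.div_eq_of_lt (hκ.trans_le (hl x hx))

theorem listLcm_dvd_iff {l : List ℕ} {m : ℕ} : listLcm l ∣ m ↔ ∀ x ∈ l, x ∣ m := by
  induction l with
  | nil => simp [listLcm]
  | cons a l ih =>
    have : listLcm (a :: l) = Nat.lcm a (listLcm l) := rfl
    simp [this, Nat.lcm_dvd_iff, ih]

theorem listLcm_pos {l : List ℕ} (hl : ∀ x ∈ l, 0 < x) : 0 < listLcm l := by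
  induction l with
  | nil => simp [listLcm]
  | cons a l ih =>
    exact Nat.lcm_pos (hl a (by simp)) (ih fun x hx => hl x (by simp [hx]))

theorem not_violates {l t : List ℕ} {b : ℕ} (hT : TerminalDenoms (l ++ t))
    (hpos : ∀ x ∈ l ++ t, 0 < x) (hb : ∀ x ∈ t, b ≤ x) : violates l b = false := by
  by_contra hv
  simp only [violates, Bool.not_eq_false, List.any_eq_true, Bool.and_eq_true, Bool.or_eq_true,
    decide_eq_true_eq] at hv
  obtain ⟨κ, -, ⟨h2, hκ⟩, h3⟩ := hv
  have hle : listLcm l ≤ listLcm (l ++ t) :=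
    Nat.le_of_dvd (listLcm_pos hpos) <| listLcm_dvd_iff.2 fun x hx =>
      listLcm_dvd_iff.1 dvd_rfl x (by simp [hx])
  have := hT κ h2 (hκ.trans hle)
  rw [floorSum_append] at this
  rcases h3 with h3 | ⟨h3, h4⟩
  · omega
  · have := floorSum_eq_zero hb h3
    omega

theorem sum_inv_le {t : List ℕ} {a : ℕ} (ha : 0 < a) (ht : ∀ x ∈ t, a ≤ x) :
    (t.map fun x : ℕ => (x : ℚ)⁻¹).sum ≤ t.length * (a : ℚ)⁻¹ := by
  have := List.sum_le_card_nsmul (t.map fun x : ℕ => (x : ℚ)⁻¹) (a : ℚ)⁻¹ (by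
    simp only [List.mem_map]
    rintro _ ⟨x, hx, rfl⟩
    have := ht x hx
    gcongr)
  simpa using this

theorem search_sound (k : ℕ) : ∀ (l t : List ℕ) (lo n d : ℕ), search k l lo n d = true →
    t.length = k → t.Pairwise (· ≤ ·) → (∀ x ∈ t, lo ≤ x) → (∀ x ∈ l ++ t, 0 < x) → 0 < d →
    (t.map fun x : ℕ => (x : ℚ)⁻¹).sum = (n : ℚ) / d → TerminalDenoms (l ++ t) →
    l ++ t ∈ terminalLists := by
  induction k with
  | zero =>
    intro l t lo n d hs ht _ _ hpos _ _ hT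
    obtain rfl := List.length_eq_zero_iff.1 ht
    have := not_violates (b := 40) hT hpos (by simp)
    simp only [search, this, Bool.false_or, decide_eq_true_eq] at hs
    simpa using hs
  | succ k ih =>
    intro l t lo n d hs ht hsort hlo hpos hd hsum hT
    obtain _ | ⟨a, t⟩ := t
    · simp at ht
    have ha : 0 < a := hpos a (by simp)
    have hat : ∀ x ∈ t, a ≤ x := (List.pairwise_cons.1 hsort).1
    have hall : ∀ x ∈ a :: t, a ≤ x := by simpa using hat
    have hle := sum_inv_le ha hall
    have hnonneg : 0 ≤ (t.map fun x : ℕ => (x : ℚ)⁻¹).sum :=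
      List.sum_nonneg (by simp only [List.mem_map]; rintro _ ⟨x, -, rfl⟩; positivity)
    rw [hsum, ht] at hle
    rw [List.map_cons, List.sum_cons] at hsum
    have haQ : (0 : ℚ) < a := by exact_mod_cast ha
    have hdQ : (0 : ℚ) < d := by exact_mod_cast hd
    have hna : d ≤ n * a := by
      have : (a : ℚ)⁻¹ ≤ n / d := by linarith
      rw [inv_le_iff_one_le_mul₀ haQ, div_mul_eq_mul_div, le_div_iff₀ hdQ, one_mul] at this
      exact_mod_cast this
    have hn : 0 < n := Nat.pos_of_ne_zero (by rintro rfl; omega)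
    have hub : a * n ≤ (k + 1) * d := by
      rw [div_le_iff₀ hdQ, mul_right_comm, ← div_eq_mul_inv, le_div_iff₀ haQ] at hle
      rw [mul_comm]
      exact_mod_cast hle
    have hub' := (Nat.le_div_iff_mul_le hn).2 hub
    have hloa := hlo a (by simp)
    simp only [search, List.all_eq_true] at hs
    have hs := hs a (by rw [List.mem_range'_1]; omega)
    have happ : l ++ a :: t = (l ++ [a]) ++ t := by simp
    rw [happ] at hT hpos ⊢
    simp only [not_violates hT hpos hat, Bool.or_false, Bool.or_eq_true, decide_eq_true_eq,
      hna.not_gt, false_or] at hs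
    refine ih _ t a _ _ hs (by simpa using ht) (List.pairwise_cons.1 hsort).2 hat hpos
      (by positivity) ?_ hT
    rw [← eq_sub_iff_add_eq'] at hsum
    rw [hsum]
    push_cast [Nat.cast_sub hna]
    field_simp

theorem search_six : search 6 [] 1 1 1 = true := by decide +kernel

/-- The fractional parts of `κ / a i` sum to `κ` minus the integer parts when `∑ 1 / a i = 1`. -/
theorem sum_fract_eq {n : ℕ} (a : Fin n → ℕ) (hsum : ∑ i, ((a i : ℚ))⁻¹ = 1) (κ : ℕ) :
    ∑ i, Int.fract ((κ : ℚ) / a i) = κ - floorSum (List.ofFn a) κ := by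
  have : ∀ i, Int.fract ((κ : ℚ) / a i) = κ * (a i : ℚ)⁻¹ - ((κ / a i : ℕ) : ℚ) := by
    intro i
    rw [Int.fract, ← natCast_floor_eq_intCast_floor (by positivity), Nat.floor_div_eq_div,
      div_eq_mul_inv]
  simp only [this, Finset.sum_sub_distrib, ← Finset.mul_sum, hsum, mul_one, floorSum,
    List.map_ofFn, List.sum_ofFn, Function.comp_def]
  push_cast
  rfl

/-- **Theorem 4.7.** A five-dimensional terminal Gorenstein weighted projective space
has weights, up to permutation, one of `(1,1,1,1,1,1)`, `(1,1,1,1,2,2)`, `(1,1,2,2,3,3)`,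
or `(1,1,1,2,3,4)`. -/
theorem stmt_11 (lam : Fin 6 → ℕ)
    (hpos : ∀ i, 0 < lam i)
    (hgcd : Finset.univ.gcd lam = 1)
    (hwf : ∀ i : Fin 6, (Finset.univ.erase i).gcd lam = 1)
    (h : ℕ) (hh : h = ∑ i, lam i)
    (hdvd : ∀ i, lam i ∣ h)
    (hterm : ∀ κ : ℤ, 2 ≤ κ → κ ≤ (h : ℤ) - 2 →
      2 ≤ ∑ i, Int.fract ((lam i : ℚ) * (κ : ℚ) / (h : ℚ)) ∧
        ∑ i, Int.fract ((lam i : ℚ) * (κ : ℚ) / (h : ℚ)) ≤ 4) :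
    ∃ σ : Equiv.Perm (Fin 6),
      (fun i => lam (σ i)) ∈ [![1, 1, 1, 1, 1, 1], ![1, 1, 1, 1, 2, 2],
        ![1, 1, 2, 2, 3, 3], ![1, 1, 1, 2, 3, 4]] := by
  have hpos_h : 0 < h := by
    rw [hh]
    exact Finset.sum_pos (fun i _ => hpos i) Finset.univ_nonempty
  have hhQ : (h : ℚ) ≠ 0 := by positivity
  set a : Fin 6 → ℕ := fun i => h / lam i
  have hmul : ∀ i, a i * lam i = h := fun i => Nat.div_mul_cancel (hdvd i)
  have hapos : ∀ i, 0 < a i := fun i => Nat.div_pos (Nat.le_of_dvd hpos_h (hdvd i)) (hpos i)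
  have hinv : ∀ i, (lam i : ℚ) / h = (a i : ℚ)⁻¹ := by
    intro i
    have h1 : (a i : ℚ) * lam i = h := by exact_mod_cast hmul i
    have h2 : (a i : ℚ) ≠ 0 := by exact_mod_cast (hapos i).ne'
    field_simp
    linarith
  have hsum : ∑ i, (a i : ℚ)⁻¹ = 1 := by
    simp only [← hinv, ← Finset.sum_div]
    rw [div_eq_one_iff_eq hhQ, hh]
    push_cast
    rfl
  set σ := Tuple.sort a
  set b : Fin 6 → ℕ := a ∘ σ
  have hmono : Monotone b := Tuple.monotone_sort a
  have hsumb : ∑ i, (b i : ℚ)⁻¹ = 1 := by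
    rw [← hsum]
    exact Equiv.sum_comp σ fun i => (a i : ℚ)⁻¹
  have hlcm : listLcm (List.ofFn b) ∣ h := by
    refine listLcm_dvd_iff.2 fun x hx => ?_
    obtain ⟨i, rfl⟩ := (List.mem_ofFn' b x).1 hx
    exact ⟨_, (hmul (σ i)).symm⟩
  have hT : TerminalDenoms (List.ofFn b) := by
    intro κ h2 hκ
    have hκh : κ + 2 ≤ h := hκ.trans (Nat.le_of_dvd hpos_h hlcm)
    have key := hterm κ (by exact_mod_cast h2) (by omega)
    have heq : ∑ i, Int.fract ((lam i : ℚ) * ((κ : ℤ) : ℚ) / (h : ℚ)) =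
        κ - floorSum (List.ofFn b) κ := by
      rw [← sum_fract_eq b hsumb, ← Equiv.sum_comp σ]
      refine Finset.sum_congr rfl fun i _ => ?_
      rw [mul_div_right_comm, hinv, Int.cast_natCast, mul_comm, ← div_eq_mul_inv]
      rfl
    rw [heq] at key
    constructor
    · have : (κ : ℚ) ≤ floorSum (List.ofFn b) κ + 4 := by linarith
      exact_mod_cast this
    · have : (floorSum (List.ofFn b) κ : ℚ) + 2 ≤ κ := by linarith
      exact_mod_cast this
  have hposb : ∀ x ∈ List.ofFn b, 0 < x := by
    intro x hx
    obtain ⟨i, rfl⟩ := (List.mem_ofFn' b x).1 hx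
    exact hapos _
  have hmem : [] ++ List.ofFn b ∈ terminalLists :=
    search_sound 6 [] (List.ofFn b) 1 1 1 search_six (by simp)
      (List.pairwise_ofFn.2 fun i j hij => hmono hij.le) hposb hposb one_pos
      (by rw [List.map_ofFn, List.sum_ofFn]; simpa using hsumb) hT
  obtain ⟨m, hm⟩ := hlcm
  have hlamb : ∀ i, b i * lam (σ i) = h := fun i => hmul (σ i)
  have hm_dvd : ∀ i, m ∣ lam i := by
    intro i
    have hi : b (σ.symm i) ∣ listLcm (List.ofFn b) :=
      listLcm_dvd_iff.1 dvd_rfl _ ((List.mem_ofFn' b _).2 ⟨_, rfl⟩)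
    obtain ⟨c, hc⟩ := hi
    have h1 := hlamb (σ.symm i)
    rw [Equiv.apply_symm_apply, hm, hc, mul_assoc] at h1
    exact ⟨c, by rw [Nat.eq_of_mul_eq_mul_left (hapos _) h1, mul_comm]⟩
  have hm1 : m = 1 := Nat.dvd_one.1 (hgcd ▸ Finset.dvd_gcd fun i _ => hm_dvd i)
  rw [hm1, mul_one] at hm
  refine ⟨Fin.revPerm.trans σ, ?_⟩
  have hval : (fun i => lam ((Fin.revPerm.trans σ) i)) = fun i => h / b (Fin.rev i) := by
    funext i
    exact (Nat.div_eq_of_eq_mul_right (hapos _) (hlamb (Fin.rev i)).symm).symm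
  have hbl : ∀ x : Fin 6 → ℕ, List.ofFn b = List.ofFn x → b = x :=
    fun x hx => List.ofFn_injective hx
  rw [hval, hm]
  simp only [List.nil_append, terminalLists, List.mem_cons, List.not_mem_nil, or_false] at hmem
  rcases hmem with hl | hl | hl | hl
  · rw [hl, hbl ![6, 6, 6, 6, 6, 6] hl]
    decide
  · rw [hl, hbl ![4, 4, 8, 8, 8, 8] hl]
    decide
  · rw [hl, hbl ![4, 4, 6, 6, 12, 12] hl]
    decide
  · rw [hl, hbl ![3, 4, 6, 12, 12, 12] hl]
    decide
end

section
/- Let (λ_0,…,λ_n) be a well-formed tuple of positive integers with gcd equal to 1 and h = λ_0 + ⋯ + λ_n, such that λ_i ∣ h for every i, and such that for every integer κ with 2 ≤ κ ≤ h − 2 one has 2 ≤ Σ_{i=0}^n {λ_i κ / h} ≤ n − 1 (i.e. ℙ(λ_0,…,λ_n) is a terminal Gorenstein weighted projective space). Suppose λ_n ≥ λ_i for all i and λ_n ≠ 1. Then k_n := h/λ_n satisfies k_n ≤ n − 1; equivalently, h ≤ (n − 1)λ_n. -/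
/-- **Corollary 5.1.** Let `ℙ(λ₀,…,λₙ)` be a terminal Gorenstein weighted projective
space with `λₙ ≥ λᵢ` for all `i` and `λₙ ≠ 1`. Then `kₙ := h/λₙ ≤ n − 1`; equivalently,
`h ≤ (n − 1)λₙ`. -/
theorem stmt_13 (n : ℕ) (lam : Fin (n + 1) → ℕ)
    (hpos : ∀ i, 0 < lam i)
    (hgcd : Finset.univ.gcd lam = 1)
    (hwf : ∀ i : Fin (n + 1), (Finset.univ.erase i).gcd lam = 1)
    (h : ℕ) (hh : h = ∑ i, lam i)
    (hdvd : ∀ i, lam i ∣ h)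
    (hterm : ∀ κ : ℤ, 2 ≤ κ → κ ≤ (h : ℤ) - 2 →
      2 ≤ ∑ i, Int.fract ((lam i : ℚ) * (κ : ℚ) / (h : ℚ)) ∧
        ∑ i, Int.fract ((lam i : ℚ) * (κ : ℚ) / (h : ℚ)) ≤ (n : ℚ) - 1)
    (hmax : ∀ i, lam i ≤ lam (Fin.last n))
    (hne : lam (Fin.last n) ≠ 1) :
    ((h / lam (Fin.last n) : ℕ) : ℤ) ≤ (n : ℤ) - 1 ∧
      (h : ℤ) ≤ ((n : ℤ) - 1) * (lam (Fin.last n) : ℤ) := by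
  have hL0 := hpos (Fin.last n)
  obtain ⟨k, hk⟩ := hdvd (Fin.last n)
  set L := lam (Fin.last n) with hL
  have hdiv : h / L = k := by rw [hk, Nat.mul_div_cancel_left _ hL0]
  have hsum : h = ∑ i : Fin n, lam i.castSucc + L := by rw [hh, Fin.sum_univ_castSucc]
  have hn : n ≠ 0 := by
    rintro rfl
    simpa [Finset.eq_empty_of_forall_notMem, Subsingleton.elim _ (0 : Fin 1)] using hwf 0
  have hlt : L < h := by
    have : 0 < ∑ i : Fin n, lam i.castSucc :=
      Finset.sum_pos (fun i _ => hpos _) ⟨⟨0, Nat.pos_of_ne_zero hn⟩, Finset.mem_univ _⟩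
    omega
  have hk2 : 2 ≤ k := by
    by_contra! hk1
    interval_cases k <;> omega
  have hkh : 2 * k ≤ h := hk ▸ Nat.mul_le_mul_right k (by omega)
  have hLq : (0 : ℚ) < L := by exact_mod_cast hL0
  have hkq : (0 : ℚ) < k := by exact_mod_cast (by omega : 0 < k)
  have hhq : (h : ℚ) = L * k := by exact_mod_cast hk
  -- The bound at `κ = h - k` suffices, as there every fractional part is `1 - λᵢ / λₙ`.
  have hfract (i : Fin (n + 1)) :
      Int.fract ((lam i : ℚ) * (((h : ℤ) - k : ℤ) : ℚ) / (h : ℚ)) = 1 - (lam i : ℚ) / L := by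
    have hi : (0 : ℚ) < lam i := by exact_mod_cast hpos i
    have hiL : (lam i : ℚ) ≤ L := by exact_mod_cast hmax i
    rw [Int.fract_eq_iff]
    refine ⟨sub_nonneg.2 ((div_le_one hLq).2 hiL), sub_lt_self _ (div_pos hi hLq),
      (lam i : ℤ) - 1, ?_⟩
    push_cast
    rw [hhq]
    field_simp
    ring
  have hS := (hterm (h - k) (by omega) (by omega)).1
  have hhs : (∑ i, (lam i : ℚ)) = L * k := by rw [← hhq, hh]; push_cast; rfl
  rw [Finset.sum_congr rfl fun i _ => hfract i, Finset.sum_sub_distrib, ← Finset.sum_div, hhs,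
    mul_div_cancel_left₀ _ hLq.ne'] at hS
  simp only [Finset.sum_const, Finset.card_univ, Fintype.card_fin, nsmul_eq_mul, mul_one] at hS
  have hkn : (k : ℤ) ≤ n - 1 := by
    have : (2 : ℚ) + k ≤ (n + 1 : ℕ) := by linarith
    have : 2 + k ≤ n + 1 := by exact_mod_cast this
    omega
  refine ⟨by rwa [hdiv], ?_⟩
  rw [hk]
  push_cast
  nlinarith
end
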